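/- arXiv:2112.13685 — 6 statements merged into one kernel-verified Lean document; each statement's English description precedes it below -/
import Mathlib

section
/- (Springer) Assume τ is a regular element, i.e. V_reg^τ ≠ ∅. Then the centralizer W^τ = {w ∈ W : τw = wτ} acts faithfully on the fixed subspace V^τ, and its image in GL(V^τ) is generated by reflections of V^τ (i.e. by elements whose fixed-point subspace has codimension 1 in V^τ). In particular W^τ acts on V^τ as a complex reflection group. -/
open Module

noncomputable section

variable {V : Type*} [AddCommGroup V] [Module ℂ V] [FiniteDimensional ℂ V]

/-- `g` is a reflection: its fixed-point subspace has codimension 1. -/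
def IsReflection {M : Type*} [AddCommGroup M] [Module ℂ M] (g : M ≃ₗ[ℂ] M) : Prop :=
  finrank ℂ (LinearMap.ker ((g : M →ₗ[ℂ] M) - LinearMap.id)) + 1 = finrank ℂ M

/-- The set of points of `V` with trivial stabilizer in `W`. -/
def VReg (W : Subgroup (V ≃ₗ[ℂ] V)) : Set V :=
  {v | ∀ w ∈ W, w v = v → w = 1}

/-- The fixed-point subspace of `τ`. -/
def fixedSubmodule (τ : V ≃ₗ[ℂ] V) : Submodule ℂ V :=
  LinearMap.ker ((τ : V →ₗ[ℂ] V) - LinearMap.id)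

section ReflectionInvariants

open MvPolynomial

section Polynomials

theorem homogeneousComponent_mul_of_isHomogeneous {ι : Type*} {p : MvPolynomial ι ℂ} {d : ℕ}
    (hp : p.IsHomogeneous d) (n : ℕ) (q : MvPolynomial ι ℂ) :
    homogeneousComponent n (p * q) =
      if d ≤ n then p * homogeneousComponent (n - d) q else 0 := by
  conv_lhs => rw [← sum_homogeneousComponent q, Finset.mul_sum, map_sum]
  have h : ∀ i, homogeneousComponent n (p * homogeneousComponent i q) =
      if d + i = n then p * homogeneousComponent i q else 0 := by
    intro i
    exact homogeneousComponent_of_mem (hp.mul (homogeneousComponent_isHomogeneous i q)) |>.trans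
      (by simp [eq_comm])
  simp_rw [h]
  split_ifs with hd
  · have h2 : ∀ i, (d + i = n) ↔ (i = n - d) := fun i => by omega
    simp_rw [h2]
    rw [Finset.sum_ite_eq']
    split_ifs with h3
    · rfl
    · rw [homogeneousComponent_eq_zero, mul_zero]
      simp at h3
      omega
  · apply Finset.sum_eq_zero
    intro i _
    rw [if_neg (by omega)]

theorem MvPolynomial.IsHomogeneous.of_mul_left {ι : Type*} {p q : MvPolynomial ι ℂ} {d e : ℕ}
    (hp : p.IsHomogeneous d) (hp0 : p ≠ 0) (hpq : (p * q).IsHomogeneous (d + e)) :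
    q.IsHomogeneous e := by
  have h := homogeneousComponent_mul_of_isHomogeneous hp (d + e) q
  rw [homogeneousComponent_of_mem hpq, if_pos rfl, if_pos (by omega),
    Nat.add_sub_cancel_left] at h
  rw [mul_left_cancel₀ hp0 h]
  exact homogeneousComponent_isHomogeneous _ _

theorem Derivation.apply_mvPolynomial_aeval {ι T : Type*} [Fintype ι] [CommRing T] [Algebra ℂ T]
    (D : Derivation ℂ T T) (f : ι → T) (Q : MvPolynomial ι ℂ) :
    D (aeval f Q) = ∑ i, aeval f (pderiv i Q) * D (f i) := by
  classical
  induction Q using MvPolynomial.induction_on with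
  | C a => simp [← algebraMap_eq]
  | add p q hp hq => simp [hp, hq, add_mul, Finset.sum_add_distrib]
  | mul_X p j hp =>
    simp only [map_mul, aeval_X, Derivation.leibniz, hp, smul_eq_mul, map_add, pderiv_X,
      add_mul, Finset.sum_add_distrib, Finset.mul_sum]
    congr 1
    · rw [Finset.sum_eq_single j] <;> simp +contextual [eq_comm]
    · exact Finset.sum_congr rfl fun i _ => by ring

theorem MvPolynomial.eq_C_of_pderiv_eq_zero {ι : Type*} {Q : MvPolynomial ι ℂ}
    (h : ∀ i, pderiv i Q = 0) : Q = C (coeff 0 Q) := by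
  classical
  ext m
  rw [coeff_C]
  split_ifs with hm
  · rw [hm]
  · obtain ⟨i, hi⟩ : ∃ i, m i ≠ 0 := by
      by_contra! h0
      exact hm (Finsupp.ext fun i => (h0 i).symm)
    have h1 := coeff_pderiv (i := i) Q (m - Finsupp.single i 1)
    rw [h i, coeff_zero, tsub_add_cancel_of_le (by simpa [Nat.one_le_iff_ne_zero] using hi)] at h1
    rcases mul_eq_zero.mp h1.symm with h2 | h2
    · exact h2
    · exfalso
      norm_cast at h2

end Polynomials

section Pullback

variable {U U' E ι κ ν : Type*} [AddCommGroup U] [Module ℂ U] [AddCommGroup U'] [Module ℂ U']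
  [AddCommGroup E] [Module ℂ E] [Fintype ι] [Fintype ν]
  (b : Basis ι ℂ U) (b' : Basis κ ℂ U') (b'' : Basis ν ℂ E)

/-- The value at `v` of a polynomial in the coordinates with respect to the basis `b`. -/
def evalAt (v : U) : MvPolynomial ι ℂ →ₐ[ℂ] ℂ := aeval (b.equivFun v)

/-- The linear form `L` as a polynomial in the coordinates with respect to `b`. -/
def linPoly (L : U →ₗ[ℂ] ℂ) : MvPolynomial ι ℂ := ∑ i, C (L (b i)) * X i

/-- Precomposition of polynomial functions with a linear map. -/
def pull (g : U →ₗ[ℂ] U') : MvPolynomial κ ℂ →ₐ[ℂ] MvPolynomial ι ℂ :=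
  aeval fun k => linPoly b (b'.coord k ∘ₗ g)

/-- The directional derivative along `u`. -/
def dirDeriv (u : U) : Derivation ℂ (MvPolynomial ι ℂ) (MvPolynomial ι ℂ) :=
  mkDerivation ℂ fun i => C (b.equivFun u i)

@[simp] theorem evalAt_X (v : U) (i : ι) : evalAt b v (X i) = b.equivFun v i := by simp [evalAt]

@[simp] theorem evalAt_C (v : U) (a : ℂ) : evalAt b v (C a) = a := by simp [evalAt]

variable {b} in
theorem ext_evalAt {p q : MvPolynomial ι ℂ} (h : ∀ v, evalAt b v p = evalAt b v q) : p = q := by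
  refine MvPolynomial.funext fun x => ?_
  have := h (b.equivFun.symm x)
  rw [evalAt, LinearEquiv.apply_symm_apply] at this
  exact this

theorem sum_apply_basis (L : U →ₗ[ℂ] ℂ) (v : U) : ∑ i, L (b i) * b.repr v i = L v := by
  have h := congrArg L (b.sum_equivFun v)
  rw [map_sum] at h
  simpa [mul_comm] using h

@[simp] theorem evalAt_linPoly (L : U →ₗ[ℂ] ℂ) (v : U) : evalAt b v (linPoly b L) = L v := by
  simpa [linPoly] using sum_apply_basis b L v

theorem linPoly_isHomogeneous (L : U →ₗ[ℂ] ℂ) : (linPoly b L).IsHomogeneous 1 :=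
  IsHomogeneous.sum _ _ _ fun i _ => isHomogeneous_C_mul_X _ i

theorem pull_isHomogeneous (g : U →ₗ[ℂ] U') {p : MvPolynomial κ ℂ} {d : ℕ}
    (hp : p.IsHomogeneous d) : (pull b b' g p).IsHomogeneous d := by
  have h := hp.aeval _ fun k => linPoly_isHomogeneous b (b'.coord k ∘ₗ g)
  rwa [one_mul] at h

theorem pull_homogeneousComponent (g : U →ₗ[ℂ] U') (n : ℕ) (p : MvPolynomial κ ℂ) :
    pull b b' g (homogeneousComponent n p) = homogeneousComponent n (pull b b' g p) := by
  conv_rhs => rw [← sum_homogeneousComponent p, map_sum, map_sum]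
  have h : ∀ i, homogeneousComponent n (pull b b' g (homogeneousComponent i p)) =
      if i = n then pull b b' g (homogeneousComponent i p) else 0 := fun i =>
    (homogeneousComponent_of_mem (pull_isHomogeneous b b' g
      (homogeneousComponent_isHomogeneous i p))).trans (by simp [eq_comm])
  simp_rw [h]
  rw [Finset.sum_ite_eq']
  split_ifs with h3
  · rfl
  · rw [homogeneousComponent_eq_zero, map_zero]
    simpa using h3

theorem linPoly_ne_zero {L : U →ₗ[ℂ] ℂ} (hL : L ≠ 0) : linPoly b L ≠ 0 := by
  contrapose! hL
  ext v
  simpa [hL] using (evalAt_linPoly b L v).symm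

variable [Fintype κ]

@[simp] theorem evalAt_pull (g : U →ₗ[ℂ] U') (v : U) (p : MvPolynomial κ ℂ) :
    evalAt b v (pull b b' g p) = evalAt b' (g v) p := by
  have : (evalAt b v).comp (pull b b' g) = evalAt b' (g v) := by
    ext k
    simp [pull]
  exact congrArg (fun f => f p) this

theorem pull_pull (g : U →ₗ[ℂ] U') (h : U' →ₗ[ℂ] E) (p : MvPolynomial ν ℂ) :
    pull b b' g (pull b' b'' h p) = pull b b'' (h ∘ₗ g) p :=
  ext_evalAt (b := b) fun v => by simp

@[simp] theorem dirDeriv_basis (i : ι) : dirDeriv b (b i) = pderiv i := by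
  classical
  ext j
  simp [dirDeriv, pderiv_X, Pi.single_apply, eq_comm]

theorem dirDeriv_pull (g : U →ₗ[ℂ] U') (u : U) (p : MvPolynomial κ ℂ) :
    dirDeriv b u (pull b b' g p) = pull b b' g (dirDeriv b' (g u) p) := by
  induction p using MvPolynomial.induction_on with
  | C a => simp [← algebraMap_eq]
  | add p q hp hq => simp [hp, hq]
  | mul_X p j hp =>
    have hX : dirDeriv b u (pull b b' g (X j)) = C (b'.equivFun (g u) j) := by
      have := sum_apply_basis b (b'.coord j ∘ₗ g) u
      simp only [LinearMap.comp_apply, Basis.coord_apply] at this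
      simp [dirDeriv, pull, linPoly, ← this]
    rw [map_mul, Derivation.leibniz, hp, hX, Derivation.leibniz, map_add]
    simp [dirDeriv, pull]

/-- The differential at `v` of a polynomial function. -/
def diffAt (v : U) (p : MvPolynomial ι ℂ) : U →ₗ[ℂ] ℂ where
  toFun u := evalAt b v (dirDeriv b u p)
  map_add' u u' := by
    have : dirDeriv b (u + u') = dirDeriv b u + dirDeriv b u' := by
      ext i; simp [dirDeriv]
    simp [this]
  map_smul' c u := by
    have : dirDeriv b (c • u) = c • dirDeriv b u := by
      ext i; simp [dirDeriv, smul_eq_C_mul]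
    simp [this]

theorem diffAt_apply (v u : U) (p : MvPolynomial ι ℂ) :
    diffAt b v p u = evalAt b v (dirDeriv b u p) := rfl

theorem diffAt_pull (g : U →ₗ[ℂ] U') (v : U) (p : MvPolynomial κ ℂ) :
    diffAt b v (pull b b' g p) = diffAt b' (g v) p ∘ₗ g := by
  ext u
  simp [diffAt_apply, dirDeriv_pull]

theorem diffAt_linPoly (L : U →ₗ[ℂ] ℂ) (v : U) : diffAt b v (linPoly b L) = L := by
  ext u
  simpa [diffAt_apply, linPoly, dirDeriv] using sum_apply_basis b L u

theorem diffAt_aeval {σ : Type*} [Fintype σ] (f : σ → MvPolynomial ι ℂ) (Q : MvPolynomial σ ℂ)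
    (v : U) : diffAt b v (aeval f Q) =
      ∑ i, evalAt b v (aeval f (pderiv i Q)) • diffAt b v (f i) := by
  ext u
  rw [diffAt_apply, Derivation.apply_mvPolynomial_aeval, map_sum, LinearMap.sum_apply]
  exact Finset.sum_congr rfl fun i _ => map_mul _ _ _

end Pullback

section Invariants

variable {U U' ι κ : Type*} [AddCommGroup U] [Module ℂ U] [AddCommGroup U'] [Module ℂ U']
  [Fintype ι] [Fintype κ] (b : Basis ι ℂ U) (b' : Basis κ ℂ U')

/-- The polynomial functions invariant under `N`. -/
def invariants (N : Subgroup (U ≃ₗ[ℂ] U)) : Subalgebra ℂ (MvPolynomial ι ℂ) where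
  carrier := {p | ∀ w ∈ N, pull b b (w : U →ₗ[ℂ] U) p = p}
  mul_mem' hp hq w hw := by rw [map_mul, hp w hw, hq w hw]
  add_mem' hp hq w hw := by rw [map_add, hp w hw, hq w hw]
  algebraMap_mem' c w _ := AlgHom.commutes _ c

variable {b} {N : Subgroup (U ≃ₗ[ℂ] U)}

theorem mem_invariants {p : MvPolynomial ι ℂ} :
    p ∈ invariants b N ↔ ∀ w ∈ N, pull b b (w : U →ₗ[ℂ] U) p = p := Iff.rfl

theorem mem_invariants_iff_evalAt {p : MvPolynomial ι ℂ} :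
    p ∈ invariants b N ↔ ∀ w ∈ N, ∀ v, evalAt b (w v) p = evalAt b v p := by
  rw [mem_invariants]
  refine forall₂_congr fun w _ => ⟨fun h v => ?_, fun h => ext_evalAt (b := b) fun v => ?_⟩
  · conv_rhs => rw [← h]
    simp
  · simpa using h v

theorem homogeneousComponent_mem_invariants {p : MvPolynomial ι ℂ} (hp : p ∈ invariants b N)
    (n : ℕ) : homogeneousComponent n p ∈ invariants b N := fun w hw => by
  rw [pull_homogeneousComponent, hp w hw]

theorem invariants_anti {N' : Subgroup (U ≃ₗ[ℂ] U)} (h : N ≤ N') :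
    invariants b N' ≤ invariants b N := fun _ hp w hw => hp w (h hw)

variable (b N) in
/-- The sum of the translates of a polynomial function under a finite group. -/
def transfer [Fintype N] : MvPolynomial ι ℂ →ₗ[ℂ] MvPolynomial ι ℂ :=
  ∑ w : N, (pull b b ((w : U ≃ₗ[ℂ] U) : U →ₗ[ℂ] U)).toLinearMap

variable [Fintype N]

theorem transfer_apply (p : MvPolynomial ι ℂ) :
    transfer b N p = ∑ w : N, pull b b ((w : U ≃ₗ[ℂ] U) : U →ₗ[ℂ] U) p := by
  simp [transfer]

theorem evalAt_transfer (p : MvPolynomial ι ℂ) (v : U) :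
    evalAt b v (transfer b N p) = ∑ w : N, evalAt b ((w : U ≃ₗ[ℂ] U) v) p := by
  simp [transfer_apply]

theorem transfer_mem_invariants (p : MvPolynomial ι ℂ) : transfer b N p ∈ invariants b N := by
  rw [mem_invariants_iff_evalAt]
  intro w hw v
  rw [evalAt_transfer, evalAt_transfer]
  exact Fintype.sum_equiv (Equiv.mulRight (⟨w, hw⟩ : N)) _ _ fun x => rfl

theorem transfer_mul {r : MvPolynomial ι ℂ} (hr : r ∈ invariants b N) (p : MvPolynomial ι ℂ) :
    transfer b N (r * p) = r * transfer b N p := by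
  simp only [transfer_apply, map_mul, Finset.mul_sum]
  exact Finset.sum_congr rfl fun w _ => by rw [hr w w.2]

theorem transfer_of_mem {r : MvPolynomial ι ℂ} (hr : r ∈ invariants b N) :
    transfer b N r = (Fintype.card N : ℂ) • r := by
  rw [transfer_apply, Finset.sum_congr rfl fun (w : N) _ => hr w w.2]
  simp [Nat.cast_smul_eq_nsmul]

theorem transfer_isHomogeneous {p : MvPolynomial ι ℂ} {n : ℕ} (hp : p.IsHomogeneous n) :
    (transfer b N p).IsHomogeneous n := by
  rw [transfer_apply]
  exact IsHomogeneous.sum _ _ _ fun w _ => pull_isHomogeneous _ _ _ hp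

theorem exists_invariant_coeffs {σ : Type*} [Fintype σ] {f : σ → MvPolynomial ι ℂ} {d : σ → ℕ}
    (hf : ∀ i, f i ∈ invariants b N) (hd : ∀ i, (f i).IsHomogeneous (d i))
    {p : MvPolynomial ι ℂ} {n : ℕ} (hp : p ∈ invariants b N) (hpn : p.IsHomogeneous n)
    (hpf : p ∈ Ideal.span (Set.range f)) :
    ∃ c : σ → MvPolynomial ι ℂ, (∀ i, c i ∈ invariants b N) ∧
      (∀ i, d i ≤ n → (c i).IsHomogeneous (n - d i)) ∧ (∀ i, n < d i → c i = 0) ∧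
      p = ∑ i, c i * f i := by
  obtain ⟨c, hc⟩ := (Ideal.mem_span_range_iff_exists_fun).mp hpf
  have hcard : (Fintype.card N : ℂ) ≠ 0 := by simp
  have h1 : p = ∑ i, f i * ((Fintype.card N : ℂ)⁻¹ • transfer b N (c i)) := by
    have h2 := transfer_of_mem hp
    rw [← hc, map_sum, hc] at h2
    rw [← inv_smul_smul₀ hcard p, ← h2, Finset.smul_sum]
    refine Finset.sum_congr rfl fun i _ => ?_
    rw [mul_comm (c i), transfer_mul (hf i), mul_smul_comm]
  set e : σ → MvPolynomial ι ℂ := fun i => (Fintype.card N : ℂ)⁻¹ • transfer b N (c i)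
  have he : ∀ i, e i ∈ invariants b N := fun i =>
    Subalgebra.smul_mem _ (transfer_mem_invariants _) _
  refine ⟨fun i => if d i ≤ n then homogeneousComponent (n - d i) (e i) else 0, fun i => ?_,
    fun i hi => ?_, fun i hi => if_neg (by omega), ?_⟩
  · beta_reduce
    split_ifs
    · exact homogeneousComponent_mem_invariants (he i) _
    · exact zero_mem _
  · simp only [if_pos hi]
    exact homogeneousComponent_isHomogeneous _ _
  · have h3 : p = homogeneousComponent n p := by
      rw [homogeneousComponent_of_mem hpn, if_pos rfl]
    rw [h3]
    conv_lhs => rw [h1, map_sum]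
    refine Finset.sum_congr rfl fun i _ => ?_
    rw [homogeneousComponent_mul_of_isHomogeneous (hd i)]
    split_ifs with h4
    · simp only [if_pos h4, mul_comm, e]
    · simp only [if_neg h4, zero_mul]

theorem invariants_le_adjoin {σ : Type*} [Fintype σ] {f : σ → MvPolynomial ι ℂ} {d : σ → ℕ}
    (hf : ∀ i, f i ∈ invariants b N) (hd : ∀ i, (f i).IsHomogeneous (d i)) (hd0 : ∀ i, 0 < d i)
    (h : ∀ n, 0 < n → ∀ p ∈ invariants b N, p.IsHomogeneous n →
      p ∈ Ideal.span (Set.range f)) :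
    invariants b N ≤ Algebra.adjoin ℂ (Set.range f) := by
  have key : ∀ n, ∀ p ∈ invariants b N, p.IsHomogeneous n →
      p ∈ Algebra.adjoin ℂ (Set.range f) := by
    intro n
    induction n using Nat.strong_induction_on with
    | _ n ih =>
    intro p hp hpn
    rcases Nat.eq_zero_or_pos n with rfl | hn
    · rw [← totalDegree_zero_iff_isHomogeneous, totalDegree_eq_zero_iff_eq_C] at hpn
      rw [hpn]
      exact Subalgebra.algebraMap_mem _ _
    · obtain ⟨c, hc, hcn, hc0, rfl⟩ := exists_invariant_coeffs hf hd hp hpn (h n hn p hp hpn)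
      refine sum_mem fun i _ => mul_mem ?_ (Algebra.subset_adjoin ⟨i, rfl⟩)
      rcases le_or_gt (d i) n with hi | hi
      · exact ih _ (by have := hd0 i; omega) _ (hc i) (hcn i hi)
      · rw [hc0 i hi]
        exact zero_mem _
  intro p hp
  rw [← sum_homogeneousComponent p]
  exact sum_mem fun i _ => key i _ (homogeneousComponent_mem_invariants hp i)
    (homogeneousComponent_isHomogeneous _ _)

end Invariants

section Chevalley

variable {U ι : Type*} [AddCommGroup U] [Module ℂ U] [Fintype ι] {b : Basis ι ℂ U}

theorem IsReflection.exists_form [FiniteDimensional ℂ U] {s : U ≃ₗ[ℂ] U} (hs : IsReflection s) :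
    ∃ (L : U →ₗ[ℂ] ℂ) (a : U), L ≠ 0 ∧ ∀ x, s x = x + L x • a := by
  set D := (s : U →ₗ[ℂ] U) - LinearMap.id
  have h1 : finrank ℂ (LinearMap.range D) = 1 := by
    have := LinearMap.finrank_range_add_finrank_ker D
    have hs' : finrank ℂ (LinearMap.ker D) + 1 = finrank ℂ U := hs
    omega
  let e : LinearMap.range D ≃ₗ[ℂ] ℂ := LinearEquiv.ofFinrankEq _ _ (by simpa using h1)
  have h2 : ∀ x, D x = e (D.rangeRestrict x) • (e.symm 1 : U) := fun x => by
    rw [← Submodule.coe_smul, ← map_smul, smul_eq_mul, mul_one, e.symm_apply_apply]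
    rfl
  refine ⟨e.toLinearMap ∘ₗ D.rangeRestrict, e.symm 1, fun h => ?_, fun x => ?_⟩
  · have h3 : D = 0 := by
      ext x
      rw [h2, show e (D.rangeRestrict x) = 0 from congrArg (fun f => f x) h]
      simp
    rw [h3, LinearMap.range_zero] at h1
    simp at h1
  · have h3 : D x = s x - x := rfl
    exact sub_eq_iff_eq_add'.mp (h3.symm.trans (h2 x))

theorem linPoly_dvd_sub_pull {s : U →ₗ[ℂ] U} {L : U →ₗ[ℂ] ℂ} {a : U}
    (h : ∀ x, s x = x + L x • a) (p : MvPolynomial ι ℂ) :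
    linPoly b L ∣ p - pull b b s p := by
  rw [← Ideal.mem_span_singleton, ← Ideal.Quotient.eq]
  have : Ideal.Quotient.mkₐ ℂ (Ideal.span {linPoly b L}) =
      (Ideal.Quotient.mkₐ ℂ (Ideal.span {linPoly b L})).comp (pull b b s) := by
    refine MvPolynomial.algHom_ext fun k => ?_
    refine Ideal.Quotient.eq.mpr (Ideal.mem_span_singleton.mpr ⟨-C (b.equivFun a k), ?_⟩)
    refine ext_evalAt (b := b) fun v => ?_
    simp [h]
  exact congrArg (fun f => f p) this

variable (b) in
/-- The ideal generated by the homogeneous invariants of positive degree. -/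
def hilbertIdeal (W : Subgroup (U ≃ₗ[ℂ] U)) : Ideal (MvPolynomial ι ℂ) :=
  Ideal.span {p | p ∈ invariants b W ∧ ∃ n, 0 < n ∧ p.IsHomogeneous n}

theorem pull_mem_hilbertIdeal {W : Subgroup (U ≃ₗ[ℂ] U)} {w : U ≃ₗ[ℂ] U} (hw : w ∈ W)
    {p : MvPolynomial ι ℂ} (hp : p ∈ hilbertIdeal b W) :
    pull b b (w : U →ₗ[ℂ] U) p ∈ hilbertIdeal b W := by
  have : hilbertIdeal b W ≤ (hilbertIdeal b W).comap (pull b b (w : U →ₗ[ℂ] U)) := by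
    refine Ideal.span_le.mpr fun q hq => ?_
    rw [SetLike.mem_coe, Ideal.mem_comap, hq.1 w hw]
    exact Ideal.subset_span hq
  exact this hp

theorem sub_pull_mem_hilbertIdeal {W : Subgroup (U ≃ₗ[ℂ] U)}
    (hW : Subgroup.closure {g : U ≃ₗ[ℂ] U | g ∈ W ∧ IsReflection g} = W) {p : MvPolynomial ι ℂ}
    (hp : ∀ s ∈ W, IsReflection s → p - pull b b (s : U →ₗ[ℂ] U) p ∈ hilbertIdeal b W)
    {w : U ≃ₗ[ℂ] U} (hw : w ∈ W) : p - pull b b (w : U →ₗ[ℂ] U) p ∈ hilbertIdeal b W := by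
  rw [← hW] at hw
  have hone : pull b b ((1 : U ≃ₗ[ℂ] U) : U →ₗ[ℂ] U) p = p :=
    ext_evalAt (b := b) fun v => by simp
  induction hw using Subgroup.closure_induction with
  | mem s hs => exact hp s hs.1 hs.2
  | one => rw [hone, sub_self]; exact zero_mem _
  | mul x y hx hy ihx ihy =>
    have h : pull b b ((x * y : U ≃ₗ[ℂ] U) : U →ₗ[ℂ] U) p =
        pull b b (y : U →ₗ[ℂ] U) (pull b b (x : U →ₗ[ℂ] U) p) :=
      ext_evalAt (b := b) fun v => by simp
    have := add_mem ihy (pull_mem_hilbertIdeal (hW ▸ hy) ihx)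
    rwa [map_sub, sub_add_sub_cancel, ← h] at this
  | inv x hx ihx =>
    have h : pull b b ((x⁻¹ : U ≃ₗ[ℂ] U) : U →ₗ[ℂ] U) (pull b b (x : U →ₗ[ℂ] U) p) = p :=
      ext_evalAt (b := b) fun v => by
        rw [evalAt_pull, evalAt_pull]
        exact congrArg (fun v => evalAt b v p) (x.apply_symm_apply v)
    have := pull_mem_hilbertIdeal (hW ▸ inv_mem hx) ihx
    rw [map_sub, h] at this
    simpa using neg_mem this

/-- Chevalley's lemma on relations with invariant coefficients. -/
theorem mem_hilbertIdeal_of_relation [FiniteDimensional ℂ U] {W : Subgroup (U ≃ₗ[ℂ] U)}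
    [Fintype W] (hW : Subgroup.closure {g : U ≃ₗ[ℂ] U | g ∈ W ∧ IsReflection g} = W)
    {σ : Type*} {s : Finset σ} {i₀ : σ} {r : σ → MvPolynomial ι ℂ}
    (hr : ∀ i, r i ∈ invariants b W)
    (hmin : ¬ ∃ a : σ → MvPolynomial ι ℂ, (∀ i, a i ∈ invariants b W) ∧
      r i₀ = ∑ i ∈ s, r i * a i) (d : ℕ) (p : σ → MvPolynomial ι ℂ)
    (hp : (p i₀).IsHomogeneous d) (h : r i₀ * p i₀ + ∑ i ∈ s, r i * p i = 0) :
    p i₀ ∈ hilbertIdeal b W := by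
  have hcard : (Fintype.card W : ℂ) ≠ 0 := by simp
  induction d generalizing p with
  | zero =>
    rw [← totalDegree_zero_iff_isHomogeneous, totalDegree_eq_zero_iff_eq_C] at hp
    set c := coeff 0 (p i₀)
    by_cases hc : c = 0
    · rw [hp, hc, C_0]
      exact zero_mem _
    exfalso
    have h1 := congrArg (transfer b W) h
    have hC : transfer b W (p i₀) = C (Fintype.card W * c) := by
      rw [hp, transfer_of_mem (show C c ∈ invariants b W from Subalgebra.algebraMap_mem _ c),
        C_mul, smul_eq_C_mul]
    simp only [map_add, map_sum, map_zero, transfer_mul (hr _), hC] at h1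
    refine hmin ⟨fun i => C (-(Fintype.card W * c)⁻¹) * transfer b W (p i), fun i =>
      mul_mem (Subalgebra.algebraMap_mem _ _) (transfer_mem_invariants _), ?_⟩
    have h2 : C (Fintype.card W * c) * C (Fintype.card W * c)⁻¹ = (1 : MvPolynomial ι ℂ) := by
      rw [← C_mul, mul_inv_cancel₀ (mul_ne_zero hcard hc), C_1]
    rw [← mul_one (r i₀), ← h2, ← mul_assoc, eq_neg_of_add_eq_zero_left h1, neg_mul,
      Finset.sum_mul, ← Finset.sum_neg_distrib]
    refine Finset.sum_congr rfl fun i _ => ?_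
    rw [C_neg]
    ring
  | succ d ih =>
    have h1 : ∀ w ∈ W, p i₀ - pull b b (w : U →ₗ[ℂ] U) (p i₀) ∈ hilbertIdeal b W := by
      refine fun w hw => sub_pull_mem_hilbertIdeal hW (fun s hs hsr => ?_) hw
      obtain ⟨L, a, hL, hs'⟩ := hsr.exists_form
      choose q hq using fun i => linPoly_dvd_sub_pull (b := b) (s := (s : U →ₗ[ℂ] U)) hs' (p i)
      rw [hq]
      refine Ideal.mul_mem_left _ _ (ih q ?_ ?_)
      · refine (linPoly_isHomogeneous b L).of_mul_left (linPoly_ne_zero b hL) ?_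
        rw [← hq, add_comm]
        exact hp.sub (pull_isHomogeneous _ _ _ hp)
      · refine mul_left_cancel₀ (linPoly_ne_zero b hL) ?_
        have h2 := congrArg (pull b b (s : U →ₗ[ℂ] U)) h
        simp only [map_add, map_sum, map_mul, hr _ s hs, map_zero] at h2
        rw [mul_zero, mul_add, Finset.mul_sum, mul_left_comm, ← hq]
        simp_rw [mul_left_comm (linPoly b L), ← hq]
        simp only [mul_sub, Finset.sum_sub_distrib]
        linear_combination h - h2
    have h3 : transfer b W (p i₀) ∈ hilbertIdeal b W :=
      Ideal.subset_span ⟨transfer_mem_invariants _, _, d.succ_pos, transfer_isHomogeneous hp⟩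
    have h4 : (Fintype.card W : ℂ) • p i₀ ∈ hilbertIdeal b W := by
      have h5 := sum_mem fun (w : W) (_ : w ∈ Finset.univ) => h1 w w.2
      rw [Finset.sum_sub_distrib, ← transfer_apply, Finset.sum_const, Finset.card_univ,
        ← Nat.cast_smul_eq_nsmul ℂ] at h5
      simpa using add_mem h5 h3
    rw [smul_eq_C_mul] at h4
    have h6 := Ideal.mul_mem_left _ (C (Fintype.card W : ℂ)⁻¹) h4
    rwa [← mul_assoc, ← C_mul, inv_mul_cancel₀ hcard, C_1, one_mul] at h6

end Chevalley

section AlgebraicIndependence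

theorem MvPolynomial.IsWeightedHomogeneous.aeval_isHomogeneous {σ ι : Type*} {d : σ → ℕ}
    {f : σ → MvPolynomial ι ℂ} (hd : ∀ i, (f i).IsHomogeneous (d i)) {P : MvPolynomial σ ℂ} {D : ℕ}
    (hP : IsWeightedHomogeneous d P D) : (aeval f P).IsHomogeneous D := by
  rw [P.as_sum, map_sum]
  refine IsHomogeneous.sum _ _ _ fun m hm => ?_
  rw [aeval_monomial, ← hP (mem_support_iff.mp hm), algebraMap_eq]
  refine IsHomogeneous.C_mul ?_ _
  rw [Finsupp.weight_apply]
  exact IsHomogeneous.prod _ _ _ fun i _ => by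
    simpa [mul_comm] using (hd i).pow (m i)

theorem MvPolynomial.IsWeightedHomogeneous.pderiv_eq_zero {σ : Type*} {d : σ → ℕ}
    {P : MvPolynomial σ ℂ} {D : ℕ} (hP : IsWeightedHomogeneous d P D) {i : σ} (hi : D < d i) :
    pderiv i P = 0 := by
  ext m
  rw [coeff_pderiv, coeff_zero]
  by_cases h : coeff (m + Finsupp.single i 1) P = 0
  · rw [h, zero_mul]
  · have := hP h
    rw [map_add, Finsupp.weight_single] at this
    simp at this
    omega

variable {U ι : Type*} [AddCommGroup U] [Module ℂ U] [Fintype ι] {b : Basis ι ℂ U}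

theorem aeval_mem_invariants {σ : Type*} {f : σ → MvPolynomial ι ℂ} {N : Subgroup (U ≃ₗ[ℂ] U)}
    (hf : ∀ i, f i ∈ invariants b N) (R : MvPolynomial σ ℂ) : aeval f R ∈ invariants b N := by
  have h := Algebra.adjoin_le (S := invariants b N) (s := Set.range f)
    (by rintro _ ⟨i, rfl⟩; exact hf i)
  rw [Algebra.adjoin_range_eq_range_aeval] at h
  exact h ⟨R, rfl⟩

variable [FiniteDimensional ℂ U] {W : Subgroup (U ≃ₗ[ℂ] U)} [Fintype W]
  {σ : Type*} [Fintype σ] {f : σ → MvPolynomial ι ℂ} {d : σ → ℕ}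

/-- If not all entries of a vector of homogeneous invariants `P` vanish and
`∑ j, P j * ∂ (f j) = 0`, then the `f j` do not minimally generate the Hilbert ideal. -/
theorem mem_span_of_sum_mul_pderiv_eq_zero
    (hW : Subgroup.closure {g : U ≃ₗ[ℂ] U | g ∈ W ∧ IsReflection g} = W)
    (hd : ∀ i, (f i).IsHomogeneous (d i)) (hd0 : ∀ i, 0 < d i)
    (hspan : hilbertIdeal b W ≤ Ideal.span (Set.range f)) {D : ℕ} {P : σ → MvPolynomial ι ℂ}
    (hPinv : ∀ i, P i ∈ invariants b W) (hP : ∀ i, (P i).IsHomogeneous (D - d i))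
    (hP0 : ∀ i, D < d i → P i = 0) (hPne : ∃ i, P i ≠ 0)
    (hrel : ∀ k, ∑ j, P j * pderiv k (f j) = 0) : ∃ i, f i ∈ Ideal.span (f '' {i}ᶜ) := by
  classical
  obtain ⟨Q, hQ, hQmin⟩ := (Set.toFinite {Q : Finset σ | ∀ j, ∃ a : σ → MvPolynomial ι ℂ,
    (∀ i, a i ∈ invariants b W) ∧ P j = ∑ i ∈ Q, P i * a i}).exists_minimal
    ⟨Finset.univ, fun j => ⟨Pi.single j 1, fun i => by
      rcases eq_or_ne i j with rfl | h
      · simp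
      · simp [h, zero_mem], by simp [Pi.single_apply]⟩⟩
  obtain ⟨i₀, hi₀⟩ : Q.Nonempty := by
    by_contra hne
    obtain ⟨j, hj⟩ := hPne
    obtain ⟨a, -, ha⟩ := hQ j
    rw [Finset.not_nonempty_iff_eq_empty.mp hne, Finset.sum_empty] at ha
    exact hj ha
  have hmin : ¬ ∃ a : σ → MvPolynomial ι ℂ, (∀ i, a i ∈ invariants b W) ∧
      P i₀ = ∑ i ∈ Q.erase i₀, P i * a i := by
    rintro ⟨a, ha, hai⟩
    refine Finset.notMem_erase i₀ Q (hQmin (y := Q.erase i₀) (fun j => ?_)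
      (Finset.erase_subset _ _) hi₀)
    obtain ⟨c, hc, hcj⟩ := hQ j
    refine ⟨fun i => a i * c i₀ + c i, fun i => add_mem (mul_mem (ha i) (hc i₀)) (hc i), ?_⟩
    rw [hcj, ← Finset.add_sum_erase Q _ hi₀]
    simp only [mul_add, Finset.sum_add_distrib, ← mul_assoc, ← Finset.sum_mul]
    rw [← hai]
  have hcoef : ∀ j, ∃ e : σ → MvPolynomial ι ℂ, (∀ i, (e i).IsHomogeneous (d i - d j)) ∧
      (∀ i, d i < d j → e i = 0) ∧ P j = ∑ i ∈ Q, P i * e i := by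
    intro j
    obtain ⟨a, -, haj⟩ := hQ j
    by_cases hj : D < d j
    · refine ⟨0, fun i => isHomogeneous_zero _ _ _, fun _ _ => rfl, ?_⟩
      simp [hP0 j hj]
    refine ⟨fun i => if d i < d j then 0 else homogeneousComponent (d i - d j) (a i),
      fun i => ?_, fun i hi => if_pos hi, ?_⟩
    · beta_reduce
      split_ifs
      · exact isHomogeneous_zero _ _ _
      · exact homogeneousComponent_isHomogeneous _ _
    · have h1 : P j = homogeneousComponent (D - d j) (P j) := by
        rw [homogeneousComponent_of_mem (hP j), if_pos rfl]
      rw [h1]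
      conv_lhs => rw [haj, map_sum]
      refine Finset.sum_congr rfl fun i _ => ?_
      by_cases hi : D < d i
      · simp [hP0 i hi]
      rw [homogeneousComponent_mul_of_isHomogeneous (hP i)]
      by_cases hij : d i < d j
      · rw [if_neg (by omega)]
        simp only [if_pos hij, mul_zero]
      · rw [if_pos (by omega), show D - d j - (D - d i) = d i - d j by omega]
        simp only [if_neg hij]
  choose e he he0 heP using hcoef
  let g : ι → σ → MvPolynomial ι ℂ := fun k i =>
    pderiv k (f i) + ∑ j ∈ Qᶜ, e j i * pderiv k (f j)
  have hg : ∀ k, g k i₀ ∈ hilbertIdeal b W := by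
    intro k
    refine mem_hilbertIdeal_of_relation hW hPinv hmin (d i₀ - 1) (g k) ?_ ?_
    · refine (hd i₀).pderiv.add (IsHomogeneous.sum _ _ _ fun j _ => ?_)
      by_cases hj : d i₀ < d j
      · rw [he0 j i₀ hj, zero_mul]
        exact isHomogeneous_zero _ _ _
      · have := (he j i₀).mul ((hd j).pderiv (i := k))
        have h1 := hd0 j
        rwa [show d i₀ - d j + (d j - 1) = d i₀ - 1 by omega] at this
    · rw [Finset.add_sum_erase Q (fun i => P i * g k i) hi₀, ← hrel k,
        ← Finset.sum_add_sum_compl Q]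
      simp only [g, mul_add, Finset.sum_add_distrib, Finset.mul_sum]
      congr 1
      rw [Finset.sum_comm]
      refine Finset.sum_congr rfl fun j _ => ?_
      conv_rhs => rw [heP j, Finset.sum_mul]
      exact Finset.sum_congr rfl fun i _ => (mul_assoc _ _ _).symm
  choose q hq using fun k => Ideal.mem_span_range_iff_exists_fun.mp (hspan (hg k))
  set J := Ideal.span (f '' {i₀}ᶜ)
  have hJ : ∀ j, j ≠ i₀ → f j ∈ J := fun j hj => Ideal.subset_span ⟨j, hj, rfl⟩
  refine ⟨i₀, ?_⟩
  have hEuler : ∑ k, X k * g k i₀ = d i₀ • f i₀ + ∑ j ∈ Qᶜ, e j i₀ * (d j • f j) := by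
    simp only [g, mul_add, Finset.sum_add_distrib, (hd _).sum_X_mul_pderiv.symm, Finset.mul_sum]
    congr 1
    rw [Finset.sum_comm]
    exact Finset.sum_congr rfl fun j _ => Finset.sum_congr rfl fun k _ => by ring
  have h1 : homogeneousComponent (d i₀) (∑ k, X k * g k i₀) ∈ J := by
    have h2 : ∑ k, X k * g k i₀ = ∑ l, f l * ∑ k, X k * q k l := by
      simp only [← hq, Finset.mul_sum]
      rw [Finset.sum_comm]
      exact Finset.sum_congr rfl fun j _ => Finset.sum_congr rfl fun k _ => by ring
    rw [h2, map_sum]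
    refine sum_mem fun l _ => ?_
    rw [homogeneousComponent_mul_of_isHomogeneous (hd l)]
    split_ifs with hl
    · by_cases hli : l = i₀
      · subst hli
        have h3 : homogeneousComponent (d l - d l) (∑ k, X k * q k l) = 0 := by
          rw [map_sum]
          refine Finset.sum_eq_zero fun k _ => ?_
          rw [homogeneousComponent_mul_of_isHomogeneous (isHomogeneous_X ℂ k), if_neg (by omega)]
        rw [h3, mul_zero]
        exact zero_mem _
      · exact Ideal.mul_mem_right _ _ (hJ l hli)
    · exact zero_mem _
  have h4 : homogeneousComponent (d i₀) (∑ k, X k * g k i₀) = ∑ k, X k * g k i₀ := by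
    have : (∑ k, X k * g k i₀).IsHomogeneous (d i₀) := by
      rw [hEuler, ← Nat.cast_smul_eq_nsmul ℂ, smul_eq_C_mul]
      refine ((hd i₀).C_mul _).add (IsHomogeneous.sum _ _ _ fun j _ => ?_)
      by_cases hj : d i₀ < d j
      · rw [he0 j i₀ hj, zero_mul]
        exact isHomogeneous_zero _ _ _
      · rw [← Nat.cast_smul_eq_nsmul ℂ, smul_eq_C_mul]
        have := (he j i₀).mul ((hd j).C_mul (d j : ℂ))
        rwa [show d i₀ - d j + d j = d i₀ by omega] at this
    rw [homogeneousComponent_of_mem this, if_pos rfl]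
  rw [h4, hEuler] at h1
  have h5 : ∑ j ∈ Qᶜ, e j i₀ * (d j • f j) ∈ J := sum_mem fun j hj =>
    Ideal.mul_mem_left _ _ (nsmul_mem (hJ j fun h => Finset.mem_compl.mp hj (h ▸ hi₀)) _)
  have h6 := (Ideal.add_mem_iff_left _ h5).mp h1
  rw [← Nat.cast_smul_eq_nsmul ℂ, smul_eq_C_mul] at h6
  have h7 := Ideal.mul_mem_left _ (C (d i₀ : ℂ)⁻¹) h6
  rwa [← mul_assoc, ← C_mul, inv_mul_cancel₀ (by have := hd0 i₀; simp; omega), C_1,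
    one_mul] at h7

theorem algebraicIndependent_of_minimal
    (hW : Subgroup.closure {g : U ≃ₗ[ℂ] U | g ∈ W ∧ IsReflection g} = W)
    (hf : ∀ i, f i ∈ invariants b W)
    (hd : ∀ i, (f i).IsHomogeneous (d i)) (hd0 : ∀ i, 0 < d i)
    (hspan : hilbertIdeal b W ≤ Ideal.span (Set.range f))
    (hmin : ∀ i, f i ∉ Ideal.span (f '' {i}ᶜ)) : AlgebraicIndependent ℂ f := by
  have key : ∀ D (P : MvPolynomial σ ℂ), IsWeightedHomogeneous d P D → aeval f P = 0 → P = 0 := by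
    intro D
    induction D using Nat.strong_induction_on with
    | _ D ih =>
    intro P hP hP0
    by_contra hne
    have hder : ∀ i, d i ≤ D → IsWeightedHomogeneous d (pderiv i P) (D - d i) := fun i hi =>
      hP.pderiv (by omega)
    suffices h : ∃ i, f i ∈ Ideal.span (f '' {i}ᶜ) from h.elim hmin
    refine mem_span_of_sum_mul_pderiv_eq_zero (D := D) (P := fun i => aeval f (pderiv i P))
      hW hd hd0 hspan (fun i => aeval_mem_invariants hf _) (fun i => ?_) (fun i hi => ?_) ?_
      (fun k => ?_)
    · rcases le_or_gt (d i) D with h | h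
      · exact (hder i h).aeval_isHomogeneous hd
      · rw [hP.pderiv_eq_zero h, map_zero]
        exact isHomogeneous_zero _ _ _
    · rw [hP.pderiv_eq_zero hi, map_zero]
    · by_contra! h
      have h1 : ∀ i, pderiv i P = 0 := by
        intro i
        rcases le_or_gt (d i) D with h2 | h2
        · exact ih (D - d i) (by have := hd0 i; omega) _ (hder i h2) (h i)
        · exact hP.pderiv_eq_zero h2
      have h2 := eq_C_of_pderiv_eq_zero h1
      rw [h2, ← algebraMap_eq, AlgHom.commutes, algebraMap_eq, C_eq_zero] at hP0
      rw [hP0, C_0] at h2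
      exact hne h2
    · rw [← Derivation.apply_mvPolynomial_aeval, hP0, map_zero]
  rw [algebraicIndependent_iff]
  intro P hP
  classical
  rw [← sum_weightedHomogeneousComponent d P]
  refine finsum_eq_zero_of_forall_eq_zero fun D => ?_
  refine key D _ (weightedHomogeneousComponent_isWeightedHomogeneous D P) ?_
  have h1 : ∀ E, homogeneousComponent D (aeval f (weightedHomogeneousComponent d E P)) =
      if E = D then aeval f (weightedHomogeneousComponent d E P) else 0 := fun E =>
    (homogeneousComponent_of_mem
      ((weightedHomogeneousComponent_isWeightedHomogeneous E P).aeval_isHomogeneous hd)).trans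
      (by simp [eq_comm])
  have hfin := weightedHomogeneousComponent_finsupp (w := d) P
  have h2 := congrArg (homogeneousComponent D) hP
  rw [← sum_weightedHomogeneousComponent d P, finsum_eq_sum _ hfin, map_sum, map_sum,
    map_zero] at h2
  simp_rw [h1] at h2
  rw [Finset.sum_ite_eq'] at h2
  split_ifs at h2 with h3
  · exact h2
  · have : weightedHomogeneousComponent d D P = 0 := by
      by_contra h
      exact h3 (hfin.mem_toFinset.mpr h)
    rw [this, map_zero]

end AlgebraicIndependence

section Regular

variable {U ι : Type*} [AddCommGroup U] [Module ℂ U] [Fintype ι] (b : Basis ι ℂ U)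

theorem diffAt_mul (v : U) (p q : MvPolynomial ι ℂ) :
    diffAt b v (p * q) = evalAt b v p • diffAt b v q + evalAt b v q • diffAt b v p := by
  ext u
  simp [diffAt_apply]

theorem diffAt_C (v : U) (a : ℂ) : diffAt b v (C a) = 0 := by
  ext u
  simp [diffAt_apply, ← algebraMap_eq]

theorem diffAt_sub (v : U) (p q : MvPolynomial ι ℂ) :
    diffAt b v (p - q) = diffAt b v p - diffAt b v q := by
  ext u
  simp [diffAt_apply]

theorem diffAt_sum {α : Type*} (s : Finset α) (v : U) (p : α → MvPolynomial ι ℂ) :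
    diffAt b v (∑ i ∈ s, p i) = ∑ i ∈ s, diffAt b v (p i) := by
  ext u
  simp [diffAt_apply]

/-- A polynomial function separating a point from a finite set. -/
theorem exists_separating {s : Set U} (hs : s.Finite) {v : U} (hv : v ∉ s) :
    ∃ q : MvPolynomial ι ℂ, evalAt b v q = 1 ∧ ∀ u ∈ s, evalAt b u q = 0 := by
  induction s, hs using Set.Finite.induction_on with
  | empty => exact ⟨1, by simp, by simp⟩
  | @insert a s _ _ ih =>
    obtain ⟨q, hq, hqs⟩ := ih fun h => hv (Set.mem_insert_of_mem _ h)
    obtain ⟨i, hi⟩ : ∃ i, b.equivFun v i ≠ b.equivFun a i := by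
      by_contra! h
      exact hv (b.equivFun.injective (funext h) ▸ Set.mem_insert _ _)
    refine ⟨q * (C (b.equivFun v i - b.equivFun a i)⁻¹ * (X i - C (b.equivFun a i))), ?_, ?_⟩
    · simp only [map_mul, map_sub, hq, evalAt_C, evalAt_X, one_mul]
      exact inv_mul_cancel₀ (sub_ne_zero.mpr hi)
    · rintro u (rfl | hu)
      · simp
      · simp [hqs u hu]

variable {b}

theorem pull_mem_invariants_of_normalizes {W : Subgroup (U ≃ₗ[ℂ] U)}
    {z : U ≃ₗ[ℂ] U} (hz : ∀ w ∈ W, z * w * z⁻¹ ∈ W)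
    {p : MvPolynomial ι ℂ} (hp : p ∈ invariants b W) :
    pull b b (z : U →ₗ[ℂ] U) p ∈ invariants b W := by
  rw [mem_invariants_iff_evalAt] at hp ⊢
  intro w hw v
  have := hp _ (hz w hw) (z v)
  simpa [LinearEquiv.mul_apply] using this

variable {W : Subgroup (U ≃ₗ[ℂ] U)} [Fintype W]

/-- At a regular point every covector is the differential of an invariant. -/
theorem exists_invariant_diffAt_eq {v : U} (hv : ∀ w ∈ W, w v = v → w = 1) (L : U →ₗ[ℂ] ℂ) :
    ∃ r ∈ invariants b W, diffAt b v r = L := by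
  classical
  obtain ⟨q, hq, hq0⟩ := exists_separating b (v := v)
    (s := {u | ∃ w ∈ W, w ≠ 1 ∧ w v = u})
    ((Set.finite_range fun w : W => (w : U ≃ₗ[ℂ] U) v).subset fun u ⟨w, hw, _, h⟩ => ⟨⟨w, hw⟩, h⟩)
    (fun ⟨w, hw, h1, h⟩ => h1 (hv w hw h))
  refine ⟨transfer b W ((linPoly b L - C (L v)) * (q * q)), transfer_mem_invariants _, ?_⟩
  rw [transfer_apply, diffAt_sum, Finset.sum_eq_single 1]
  · rw [diffAt_pull]
    simp only [OneMemClass.coe_one, LinearEquiv.coe_coe, LinearEquiv.coe_one, id_eq]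
    rw [diffAt_mul, diffAt_sub, diffAt_linPoly, diffAt_C]
    ext u
    simp [hq]
  · intro w _ hw
    have h0 := hq0 _ ⟨w, w.2, fun h => hw (Subtype.ext h), rfl⟩
    rw [diffAt_pull, LinearEquiv.coe_coe, diffAt_mul, diffAt_mul]
    simp [h0]
  · simp

end Regular

section Restriction

variable {U E ι κ : Type*} [AddCommGroup U] [Module ℂ U] [Fintype ι] {b : Basis ι ℂ U}
  [AddCommGroup E] [Module ℂ E] [Fintype κ] {b' : Basis κ ℂ E}
  {W Z : Subgroup (U ≃ₗ[ℂ] U)} [Fintype Z] {j : E →ₗ[ℂ] U}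

/-- The Hilbert ideal is generated by invariants that are either invariant under the
normalizing group `Z` as well, or vanish on the fixed space of `Z`. -/
theorem hilbertIdeal_eq_span (hZ : ∀ z ∈ Z, ∀ w ∈ W, z * w * z⁻¹ ∈ W)
    (hj : ∀ z ∈ Z, ∀ x, z (j x) = j x) :
    hilbertIdeal b W = Ideal.span {p | (p ∈ invariants b W ∧ ∃ n, 0 < n ∧ p.IsHomogeneous n) ∧
      (p ∈ invariants b Z ∨ pull b' b j p = 0)} := by
  refine le_antisymm (Ideal.span_le.mpr ?_) (Ideal.span_mono fun p hp => hp.1)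
  rintro p ⟨hp, n, hn, hpn⟩
  have hcard : (Fintype.card Z : ℂ) ≠ 0 := by simp
  set a := (Fintype.card Z : ℂ)⁻¹ • transfer b Z p
  have ha : a ∈ invariants b W := by
    refine Subalgebra.smul_mem _ ?_ _
    rw [transfer_apply]
    exact sum_mem fun z _ => pull_mem_invariants_of_normalizes (hZ z z.2) hp
  have han : a.IsHomogeneous n := by
    simp only [a, smul_eq_C_mul]
    exact (transfer_isHomogeneous hpn).C_mul _
  rw [← add_sub_cancel a p]
  refine Ideal.add_mem _ (Ideal.subset_span ⟨⟨ha, n, hn, han⟩, Or.inl ?_⟩)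
    (Ideal.subset_span ⟨⟨sub_mem hp ha, n, hn, hpn.sub han⟩, Or.inr ?_⟩)
  · exact Subalgebra.smul_mem _ (transfer_mem_invariants p) _
  · refine ext_evalAt (b := b') fun x => ?_
    simp only [evalAt_pull, map_sub, a, map_smul, evalAt_transfer, map_zero]
    rw [Finset.sum_congr rfl fun (z : Z) _ => by rw [hj z z.2 x]]
    simp [hcard]

theorem Ideal.exists_minimal_generators {R : Type*} [CommRing R] [IsNoetherianRing R] (s : Set R) :
    ∃ t : Finset R, (t : Set R) ⊆ s ∧ Ideal.span s = Ideal.span t ∧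
      ∀ x ∈ t, x ∉ Ideal.span ((t : Set R) \ {x}) := by
  classical
  obtain ⟨t₀, ht₀⟩ := (Submodule.fg_span_iff_fg_span_finset_subset s).mp
    (IsNoetherian.noetherian (Ideal.span s))
  obtain ⟨t, ⟨hts, ht⟩, hmin⟩ := exists_minimal_of_wellFoundedLT
    (fun t : Finset R => (t : Set R) ⊆ s ∧ Ideal.span s = Ideal.span (t : Set R)) ⟨t₀, ht₀⟩
  refine ⟨t, hts, ht, fun x hx hxt => ?_⟩
  refine Finset.notMem_erase x t (hmin (y := t.erase x) ⟨?_, ?_⟩ (Finset.erase_subset _ _) hx)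
  · exact (Finset.coe_subset.mpr (Finset.erase_subset _ _)).trans hts
  · rw [ht, Finset.coe_erase]
    refine le_antisymm (Ideal.span_le.mpr fun y hy => ?_) (Ideal.span_mono Set.sdiff_subset)
    by_cases h : y = x
    · exact h ▸ hxt
    · exact Ideal.subset_span ⟨hy, h⟩

variable [Fintype W]

/-- Basic invariants of `W` adapted to the fixed space of `Z`, and their number. -/
theorem exists_basic_invariants [FiniteDimensional ℂ U]
    (hW : Subgroup.closure {g : U ≃ₗ[ℂ] U | g ∈ W ∧ IsReflection g} = W)
    (hZ : ∀ z ∈ Z, ∀ w ∈ W, z * w * z⁻¹ ∈ W) (hj : ∀ z ∈ Z, ∀ x, z (j x) = j x) :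
    ∃ (t : Finset (MvPolynomial ι ℂ)), (∀ p ∈ t, (p ∈ invariants b W ∧
      ∃ n, 0 < n ∧ p.IsHomogeneous n) ∧ (p ∈ invariants b Z ∨ pull b' b j p = 0)) ∧
      t.card ≤ finrank ℂ U ∧
      invariants b W ≤ (aeval (R := ℂ) (fun p : t => (p : MvPolynomial ι ℂ))).range := by
  obtain ⟨t, ht, hspan, hmin⟩ := Ideal.exists_minimal_generators
    {p | (p ∈ invariants b W ∧ ∃ n, 0 < n ∧ p.IsHomogeneous n) ∧
      (p ∈ invariants b Z ∨ pull b' b j p = 0)}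
  rw [← hilbertIdeal_eq_span hZ hj] at hspan
  set f : t → MvPolynomial ι ℂ := fun p => p
  have hrange : Set.range f = t := Subtype.range_coe
  rw [← hrange] at hspan
  choose d hd0 hd using fun p : t => (ht p.2).1.2
  have hf : ∀ p, f p ∈ invariants b W := fun p => (ht p.2).1.1
  refine ⟨t, ht, ?_, ?_⟩
  · have hind : AlgebraicIndependent ℂ f :=
      algebraicIndependent_of_minimal hW hf hd hd0 hspan.le fun i hi => hmin i i.2 <| by
        refine Ideal.span_mono ?_ hi
        rintro _ ⟨k, hk, rfl⟩
        exact ⟨k.2, fun h => hk (Subtype.ext h)⟩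
    have h := hind.lift_cardinalMk_le_trdeg
    rw [MvPolynomial.trdeg_of_isDomain] at h
    rw [finrank_eq_card_basis b]
    simpa using h
  · rw [← Algebra.adjoin_range_eq_range_aeval]
    exact invariants_le_adjoin hf hd hd0 fun n hn p hp hpn =>
      hspan.le (Ideal.subset_span ⟨hp, n, hn, hpn⟩)

/-- Restricted basic invariants on the fixed space of `Z`. -/
theorem exists_restricted_invariants [FiniteDimensional ℂ U]
    (hW : Subgroup.closure {g : U ≃ₗ[ℂ] U | g ∈ W ∧ IsReflection g} = W)
    (hZ : ∀ z ∈ Z, ∀ w ∈ W, z * w * z⁻¹ ∈ W) (hjinj : Function.Injective j)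
    (hj : ∀ u, u ∈ LinearMap.range j ↔ ∀ z ∈ Z, z u = u)
    {x₀ : E} (hx₀ : ∀ w ∈ W, w (j x₀) = j x₀ → w = 1) :
    ∃ (f : κ → MvPolynomial κ ℂ) (d : κ → ℕ), (∀ k, (f k).IsHomogeneous (d k)) ∧
      (∀ k, 0 < d k) ∧ (∀ k, ∃ p ∈ invariants b W, f k = pull b' b j p) ∧
      (∀ p ∈ invariants b W, pull b' b j p ∈ Algebra.adjoin ℂ (Set.range f)) ∧
      LinearIndependent ℂ (fun k => diffAt b' x₀ (f k)) := by
  classical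
  have hjz : ∀ z ∈ Z, ∀ x, z (j x) = j x := fun z hz x => (hj _).mp ⟨x, rfl⟩ z hz
  obtain ⟨t, ht, hcard, hgen⟩ := exists_basic_invariants (b := b) (b' := b') hW hZ hjz
  set f : t → MvPolynomial ι ℂ := fun p => p
  have hspan : ⊤ ≤ Submodule.span ℂ (Set.range fun i => diffAt b (j x₀) (f i)) := by
    rintro L -
    obtain ⟨r, hr, rfl⟩ := exists_invariant_diffAt_eq (b := b) hx₀ L
    obtain ⟨P, rfl⟩ := hgen hr
    change diffAt b (j x₀) (aeval f P) ∈ _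
    rw [diffAt_aeval]
    exact sum_mem fun i _ => Submodule.smul_mem _ _ (Submodule.subset_span ⟨i, rfl⟩)
  have hind : LinearIndependent ℂ fun i => diffAt b (j x₀) (f i) :=
    linearIndependent_of_top_le_span_of_card_le_finrank hspan
      (by rw [Subspace.dual_finrank_eq]; simpa using hcard)
  let I := {i : t // f i ∈ invariants b Z}
  let g : I → (E →ₗ[ℂ] ℂ) := fun i => diffAt b' x₀ (pull b' b j (f i))
  have hgj : ∀ i : I, g i = diffAt b (j x₀) (f i) ∘ₗ j := fun i => diffAt_pull _ _ _ _ _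
  have hgind : LinearIndependent ℂ g := by
    rw [Fintype.linearIndependent_iff]
    intro c hc
    have hμ : ∑ i, c i • diffAt b (j x₀) (f (i : I)) = 0 := by
      ext u
      set μ := ∑ i, c i • diffAt b (j x₀) (f (i : I))
      have h1 : ∀ z ∈ Z, μ (z u) = μ u := by
        intro z hz
        simp only [μ, LinearMap.sum_apply, LinearMap.smul_apply]
        refine Finset.sum_congr rfl fun i _ => ?_
        conv_rhs => rw [← i.2 z hz, diffAt_pull]
        simp [hjz z hz]
      obtain ⟨x, hx⟩ : ∑ z : Z, (z : U ≃ₗ[ℂ] U) u ∈ LinearMap.range j := by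
        rw [hj]
        intro z hz
        rw [map_sum]
        exact Fintype.sum_equiv (Equiv.mulLeft (⟨z, hz⟩ : Z)) _ _ fun x => rfl
      have h2 : μ (j x) = 0 := by
        have := LinearMap.congr_fun hc x
        simp only [hgj] at this
        simpa [μ] using this
      rw [hx, map_sum, Finset.sum_congr rfl fun (z : Z) _ => h1 z z.2] at h2
      simpa using h2
    have hind' := hind.comp _ (Subtype.val_injective (p := fun i => f i ∈ invariants b Z))
    exact Fintype.linearIndependent_iff.mp hind' c hμ
  have hgspan : ⊤ ≤ Submodule.span ℂ (Set.range g) := by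
    rintro L -
    obtain ⟨π, hπ⟩ := j.exists_leftInverse_of_injective (LinearMap.ker_eq_bot.mpr hjinj)
    obtain ⟨c, hc⟩ := (Submodule.mem_span_range_iff_exists_fun ℂ).mp
      (hspan (Submodule.mem_top (x := L ∘ₗ π)))
    have hL : L = ∑ i, c i • (diffAt b (j x₀) (f i) ∘ₗ j) := by
      rw [← L.comp_id, ← hπ, ← LinearMap.comp_assoc, ← hc]
      ext x
      simp
    rw [hL]
    refine sum_mem fun i _ => Submodule.smul_mem _ _ ?_
    rcases (ht i i.2).2 with h | h
    · exact Submodule.subset_span ⟨⟨i, h⟩, hgj _⟩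
    · rw [← diffAt_pull b' b, h, ← C_0, diffAt_C]
      exact zero_mem _
  have hEfin : FiniteDimensional ℂ E := b'.finiteDimensional_of_finite
  have hcardI : Fintype.card κ = Fintype.card I := by
    rw [← finrank_eq_card_basis b', ← Subspace.dual_finrank_eq,
      finrank_eq_card_basis (Basis.mk hgind hgspan)]
  let e : κ ≃ I := Fintype.equivOfCardEq hcardI
  choose d hd0 hd using fun p : t => (ht p p.2).1.2
  refine ⟨fun k => pull b' b j (f (e k)), fun k => d (e k),
    fun k => pull_isHomogeneous _ _ _ (hd _), fun k => hd0 _,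
    fun k => ⟨_, (ht _ (e k).1.2).1.1, rfl⟩, fun p hp => ?_, hgind.comp e e.injective⟩
  obtain ⟨P, rfl⟩ := hgen hp
  change pull b' b j (aeval f P) ∈ _
  rw [comp_aeval_apply]
  refine Algebra.adjoin_le (S := Algebra.adjoin ℂ _)
    (s := Set.range fun i => pull b' b j (f i)) ?_ ?_
  · rintro _ ⟨i, rfl⟩
    rcases (ht i i.2).2 with h | h
    · exact Algebra.subset_adjoin ⟨e.symm ⟨i, h⟩, by simp⟩
    · beta_reduce
      rw [h]
      exact zero_mem _
  · rw [Algebra.adjoin_range_eq_range_aeval]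
    exact ⟨P, rfl⟩

end Restriction

section Jacobian

variable {κ : Type*} [Fintype κ] [DecidableEq κ] (f : κ → MvPolynomial κ ℂ)

/-- The Jacobian matrix of a square system of polynomials. -/
def jacobianMatrix : Matrix κ κ (MvPolynomial κ ℂ) := Matrix.of fun k l => pderiv l (f k)

/-- The derivation `J • ∂/∂(f i)`, where `J` is the Jacobian of `f`. -/
def adjDeriv (i : κ) : Derivation ℂ (MvPolynomial κ ℂ) (MvPolynomial κ ℂ) :=
  ∑ k, (jacobianMatrix f).adjugate k i • pderiv k

theorem adjDeriv_apply (i : κ) (p : MvPolynomial κ ℂ) :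
    adjDeriv f i p = ∑ k, (jacobianMatrix f).adjugate k i * pderiv k p := by
  have h := congrFun (map_sum (Derivation.coeFnAddMonoidHom (R := ℂ) (A := MvPolynomial κ ℂ)
    (M := MvPolynomial κ ℂ)) (fun k => (jacobianMatrix f).adjugate k i • pderiv k) Finset.univ) p
  rw [Finset.sum_apply] at h
  exact h

theorem adjDeriv_apply_self (i l : κ) :
    adjDeriv f i (f l) = if l = i then (jacobianMatrix f).det else 0 := by
  have h := congrFun (congrFun (jacobianMatrix f).mul_adjugate l) i
  rw [Matrix.mul_apply] at h
  rw [adjDeriv_apply, Finset.sum_congr rfl fun k _ => mul_comm _ _]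
  simpa [Matrix.one_apply, jacobianMatrix] using h

theorem adjDeriv_aeval (i : κ) (Q : MvPolynomial κ ℂ) :
    adjDeriv f i (aeval f Q) = (jacobianMatrix f).det * aeval f (pderiv i Q) := by
  rw [Derivation.apply_mvPolynomial_aeval]
  simp [adjDeriv_apply_self, mul_comm]

theorem sum_pderiv_mul_adjDeriv (k : κ) (p : MvPolynomial κ ℂ) :
    ∑ i, pderiv k (f i) * adjDeriv f i p = (jacobianMatrix f).det * pderiv k p := by
  simp only [adjDeriv_apply, Finset.mul_sum]
  rw [Finset.sum_comm]
  have h : ∀ l, ∑ i, pderiv k (f i) * ((jacobianMatrix f).adjugate l i * pderiv l p) =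
      if l = k then (jacobianMatrix f).det * pderiv l p else 0 := by
    intro l
    have h := congrArg (· * pderiv l p) (congrFun (congrFun (jacobianMatrix f).adjugate_mul l) k)
    simp only [Matrix.mul_apply, Finset.sum_mul] at h
    trans ∑ i, (jacobianMatrix f).adjugate l i * jacobianMatrix f i k * pderiv l p
    · exact Finset.sum_congr rfl fun i _ => by rw [jacobianMatrix, Matrix.of_apply]; ring
    · rw [h]
      simp [Matrix.one_apply]
  rw [Finset.sum_congr rfl fun l _ => h l]
  simp

variable {f}

theorem algebraicIndependent_of_jacobian_ne_zero (h : (jacobianMatrix f).det ≠ 0) :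
    AlgebraicIndependent ℂ f := by
  have key : ∀ (n : ℕ) (Q : MvPolynomial κ ℂ), (∀ m ∈ Q.support, m.degree < n) →
      aeval f Q = 0 → Q = 0 := by
    intro n
    induction n with
    | zero =>
      intro Q hQ _
      rw [← MvPolynomial.support_eq_empty]
      exact Finset.eq_empty_of_forall_notMem fun m hm => by simpa using hQ m hm
    | succ n ih =>
      intro Q hQ hQ0
      have h1 : ∀ i, pderiv i Q = 0 := by
        intro i
        refine ih _ (fun m hm => ?_) ?_
        · rw [MvPolynomial.mem_support_iff, coeff_pderiv] at hm
          have := hQ _ (MvPolynomial.mem_support_iff.mpr (left_ne_zero_of_mul hm))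
          simpa using this
        · have := adjDeriv_aeval f i Q
          rw [hQ0, map_zero] at this
          exact (mul_eq_zero.mp this.symm).resolve_left h
      have h2 := eq_C_of_pderiv_eq_zero h1
      rw [h2, ← algebraMap_eq, AlgHom.commutes, algebraMap_eq, C_eq_zero] at hQ0
      rw [h2, hQ0, C_0]
  rw [algebraicIndependent_iff]
  exact fun Q hQ => key (Q.support.sup Finsupp.degree + 1) Q
    (fun m hm => Nat.lt_succ_of_le (Finset.le_sup (f := Finsupp.degree) hm)) hQ

theorem jacobian_ne_zero {E : Type*} [AddCommGroup E] [Module ℂ E] {b : Basis κ ℂ E} {x : E}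
    (h : LinearIndependent ℂ fun k => diffAt b x (f k)) : (jacobianMatrix f).det ≠ 0 := by
  intro h0
  have h1 : ((jacobianMatrix f).map (evalAt b x)).det = 0 := by
    have := (evalAt b x).map_det (jacobianMatrix f)
    rw [h0, map_zero] at this
    exact this.symm
  obtain ⟨c, hc, hc0⟩ := Matrix.exists_vecMul_eq_zero_iff.mpr h1
  refine hc (funext (Fintype.linearIndependent_iff.mp h c ?_))
  refine b.ext fun l => ?_
  have := congrFun hc0 l
  simpa [Matrix.vecMul, dotProduct, jacobianMatrix, diffAt_apply, dirDeriv_basis] using this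

end Jacobian

section Normality

theorem mem_of_isIntegral_of_mul_mem {A B : Type*} [CommRing A] [IsDomain A]
    [IsIntegrallyClosed A] [CommRing B] [IsDomain B] [Algebra A B] [FaithfulSMul A B] {t : B}
    (ht : IsIntegral A t) {a c : A} (ha : a ≠ 0) (h : algebraMap A B a * t = algebraMap A B c) :
    t ∈ (algebraMap A B).range := by
  let K := FractionRing A
  let L := FractionRing B
  have hinj : Function.Injective (algebraMap A L) := by
    rw [IsScalarTower.algebraMap_eq A B L]
    exact (IsFractionRing.injective B L).comp (FaithfulSMul.algebraMap_injective A B)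
  let φ : K →ₐ[A] L := IsFractionRing.liftAlgHom (g := Algebra.ofId A L) hinj
  have ha' : algebraMap A K a ≠ 0 := by simpa using ha
  have h1 : φ (algebraMap A K c / algebraMap A K a) = algebraMap B L t := by
    rw [map_div₀, AlgHom.commutes, AlgHom.commutes, div_eq_iff
      (by simpa using hinj.ne ha), IsScalarTower.algebraMap_apply A B L, ← h, map_mul, mul_comm,
      ← IsScalarTower.algebraMap_apply A B L]
  have h2 : IsIntegral A (algebraMap A K c / algebraMap A K a) := by
    rw [← isIntegral_algHom_iff φ φ.toRingHom.injective, h1]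
    exact ht.map (IsScalarTower.toAlgHom A B L)
  obtain ⟨y, hy⟩ := IsIntegrallyClosed.isIntegral_iff.mp h2
  refine ⟨y, IsFractionRing.injective B L ?_⟩
  rw [← h1, ← hy, AlgHom.commutes, IsScalarTower.algebraMap_apply A B L]

end Normality

section OrbitPolynomial

variable {U ι : Type*} [AddCommGroup U] [Module ℂ U] [Fintype ι] (b : Basis ι ℂ U)
  (N : Subgroup (U ≃ₗ[ℂ] U)) [Fintype N]

open scoped Classical in
/-- The orbit of a polynomial function. -/
def orbitFinset (p : MvPolynomial ι ℂ) : Finset (MvPolynomial ι ℂ) :=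
  Finset.univ.image fun w : N => pull b b ((w : U ≃ₗ[ℂ] U) : U →ₗ[ℂ] U) p

theorem mem_orbitFinset {p q : MvPolynomial ι ℂ} :
    q ∈ orbitFinset b N p ↔ ∃ w ∈ N, pull b b (w : U →ₗ[ℂ] U) p = q := by
  simp [orbitFinset]

theorem self_mem_orbitFinset (p : MvPolynomial ι ℂ) : p ∈ orbitFinset b N p :=
  (mem_orbitFinset b N).mpr ⟨1, one_mem _, ext_evalAt (b := b) fun v => by simp⟩

theorem coeff_prod_orbit_mem_invariants (p : MvPolynomial ι ℂ) (n : ℕ) :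
    (∏ q ∈ orbitFinset b N p, (Polynomial.X - Polynomial.C q)).coeff n ∈ invariants b N := by
  classical
  intro w hw
  have hinj : Function.Injective (pull b b (w : U →ₗ[ℂ] U)) := by
    refine Function.LeftInverse.injective (g := pull b b ((w⁻¹ : U ≃ₗ[ℂ] U) : U →ₗ[ℂ] U))
      fun q => ?_
    rw [pull_pull]
    exact ext_evalAt (b := b) fun v => by simp
  have himg : (orbitFinset b N p).image (pull b b (w : U →ₗ[ℂ] U)) = orbitFinset b N p := by
    refine Finset.eq_of_subset_of_card_le (fun q hq => ?_)
      (Finset.card_image_of_injective _ hinj).ge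
    obtain ⟨r, hr, rfl⟩ := Finset.mem_image.mp hq
    obtain ⟨w', hw', rfl⟩ := (mem_orbitFinset b N).mp hr
    refine (mem_orbitFinset b N).mpr ⟨w' * w, mul_mem hw' hw, ?_⟩
    rw [pull_pull]
    rfl
  have h : (∏ q ∈ orbitFinset b N p, (Polynomial.X - Polynomial.C q)).map
      (pull b b (w : U →ₗ[ℂ] U)).toRingHom =
      ∏ q ∈ orbitFinset b N p, (Polynomial.X - Polynomial.C q) := by
    rw [Polynomial.map_prod]
    conv_rhs => rw [← himg, Finset.prod_image fun _ _ _ _ h => hinj h]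
    exact Finset.prod_congr rfl fun q _ => by simp
  conv_rhs => rw [← h]
  rw [Polynomial.coeff_map]
  rfl

end OrbitPolynomial

section Stable

variable {U E ι κ : Type*} [AddCommGroup U] [Module ℂ U] [Fintype ι] {b : Basis ι ℂ U}
  [AddCommGroup E] [Module ℂ E] [Fintype κ] {b' : Basis κ ℂ E}
  {W Z : Subgroup (U ≃ₗ[ℂ] U)} {j : E →ₗ[ℂ] U}

/-- An element of `W` mapping a regular point fixed by `Z` to a point fixed by `Z` commutes
with `Z`. -/
theorem commute_of_regular (hZ : ∀ z ∈ Z, ∀ w ∈ W, z * w * z⁻¹ ∈ W) {v : U}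
    (hv : ∀ w ∈ W, w v = v → w = 1) (hvZ : ∀ z ∈ Z, z v = v) {w : U ≃ₗ[ℂ] U} (hw : w ∈ W)
    (h : ∀ z ∈ Z, z (w v) = w v) {z : U ≃ₗ[ℂ] U} (hz : z ∈ Z) : z * w = w * z := by
  have h1 : w⁻¹ * (z * w * z⁻¹) = 1 := by
    refine hv _ (mul_mem (inv_mem hw) (hZ z hz w hw)) ?_
    rw [LinearEquiv.mul_apply, LinearEquiv.mul_apply, LinearEquiv.mul_apply,
      hvZ _ (inv_mem hz), h z hz, ← LinearEquiv.mul_apply, inv_mul_cancel]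
    rfl
  rwa [inv_mul_eq_one, eq_mul_inv_iff_mul_eq, eq_comm] at h1

theorem mem_range_of_regular (hZ : ∀ z ∈ Z, ∀ w ∈ W, z * w * z⁻¹ ∈ W)
    (hj : ∀ u, u ∈ LinearMap.range j ↔ ∀ z ∈ Z, z u = u)
    {x₀ : E} (hx₀ : ∀ w ∈ W, w (j x₀) = j x₀ → w = 1) {w : U ≃ₗ[ℂ] U} (hw : w ∈ W)
    (h : w (j x₀) ∈ LinearMap.range j) (x : E) : w (j x) ∈ LinearMap.range j := by
  rw [hj] at h ⊢
  intro z hz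
  have hjz : ∀ x, ∀ z ∈ Z, z (j x) = j x := fun x => (hj _).mp ⟨x, rfl⟩
  rw [← LinearEquiv.mul_apply, commute_of_regular hZ hx₀ (hjz x₀) hw h hz,
    LinearEquiv.mul_apply, hjz x z hz]

variable [Fintype W]

theorem isIntegral_of_stable {A : Subalgebra ℂ (MvPolynomial κ ℂ)}
    (hA : ∀ p ∈ invariants b W, pull b' b j p ∈ A) {π : U →ₗ[ℂ] E} (hπ : π ∘ₗ j = LinearMap.id)
    (t : MvPolynomial κ ℂ) : IsIntegral A t := by
  let F := ∏ q ∈ orbitFinset b W (pull b b' π t), (Polynomial.X - Polynomial.C q)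
  have hF : F.Monic := Polynomial.monic_prod_of_monic _ _ fun q _ => Polynomial.monic_X_sub_C q
  have hlift : F.map (pull b' b j).toRingHom ∈ Polynomial.lifts (algebraMap A _) := by
    rw [Polynomial.lifts_iff_coeff_lifts]
    intro n
    rw [Polynomial.coeff_map]
    exact ⟨⟨_, hA _ (coeff_prod_orbit_mem_invariants b W _ n)⟩, rfl⟩
  obtain ⟨q, hq, -, hqm⟩ := Polynomial.lifts_and_natDegree_eq_and_monic hlift (hF.map _)
  refine ⟨q, hqm, ?_⟩
  have ht : t = (pull b' b j).toRingHom (pull b b' π t) := by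
    change t = pull b' b j (pull b b' π t)
    rw [pull_pull, hπ]
    exact ext_evalAt (b := b') fun v => by simp
  rw [← Polynomial.eval_map, hq]
  conv_lhs => rw [ht]
  rw [Polynomial.eval_map, Polynomial.eval₂_hom, Polynomial.eval_prod,
    Finset.prod_eq_zero (self_mem_orbitFinset b W _) (by simp), map_zero]

/-- A polynomial function `t` on the fixed space of `Z` that is stable under the centralizer of `Z`
in `W` is a quotient of
restrictions of invariants of `W`. -/
theorem exists_mul_eq_of_stable (hZ : ∀ z ∈ Z, ∀ w ∈ W, z * w * z⁻¹ ∈ W)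
    (hj : ∀ u, u ∈ LinearMap.range j ↔ ∀ z ∈ Z, z u = u)
    {x₀ : E} (hx₀ : ∀ w ∈ W, w (j x₀) = j x₀ → w = 1)
    {π : U →ₗ[ℂ] E} (hπ : π ∘ₗ j = LinearMap.id) {t : MvPolynomial κ ℂ}
    (ht : ∀ w ∈ W, (∀ z ∈ Z, z * w = w * z) →
      ∀ x y, w (j x) = j y → evalAt b' y t = evalAt b' x t) :
    ∃ r₁ ∈ invariants b W, ∃ r₂ ∈ invariants b W, pull b' b j r₂ ≠ 0 ∧
      pull b' b j r₂ * t = pull b' b j r₁ := by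
  classical
  have hjz : ∀ z ∈ Z, ∀ x, z (j x) = j x := fun z hz x => (hj _).mp ⟨x, rfl⟩ z hz
  have key : ∀ w : W, ∃ ρ : MvPolynomial ι ℂ, evalAt b (j x₀) ρ ≠ 0 ∧ (w ≠ 1 →
      evalAt b ((w : U ≃ₗ[ℂ] U) (j x₀)) ρ = 0) ∧
      ((w : U ≃ₗ[ℂ] U) (j x₀) ∉ LinearMap.range j →
        ∀ x, evalAt b ((w : U ≃ₗ[ℂ] U) (j x)) ρ = 0) := by
    rintro ⟨w, hw⟩
    by_cases hwr : w (j x₀) ∈ LinearMap.range j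
    · by_cases hw1 : w = 1
      · exact ⟨1, by simp, fun h => absurd (Subtype.ext hw1) h, fun h => absurd hwr h⟩
      · obtain ⟨q, hq, hq0⟩ := exists_separating b (Set.finite_singleton (w (j x₀)))
          (v := j x₀) fun h => hw1 (hx₀ w hw (Set.mem_singleton_iff.mp h).symm)
        exact ⟨q, by simp [hq], fun _ => hq0 _ rfl, fun h => absurd hwr h⟩
    · obtain ⟨z, hz, hzw⟩ : ∃ z ∈ Z, z (w⁻¹ (j x₀)) ≠ w⁻¹ (j x₀) := by
        by_contra! h
        refine hwr ((hj _).mpr fun z hz => ?_)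
        have h1 := commute_of_regular hZ hx₀ (fun z hz => hjz z hz x₀) (inv_mem hw) h hz
        rw [← LinearEquiv.mul_apply, (Commute.inv_right_iff.mp h1).eq, LinearEquiv.mul_apply,
          hjz z hz]
      obtain ⟨k, hk⟩ : ∃ k, b.coord k (z (w⁻¹ (j x₀)) - w⁻¹ (j x₀)) ≠ 0 := by
        by_contra! h
        exact hzw (sub_eq_zero.mp (b.ext_elem fun k => by simpa using h k))
      let L : U →ₗ[ℂ] ℂ := b.coord k ∘ₗ
        ((z * w⁻¹ : U ≃ₗ[ℂ] U) - (w⁻¹ : U ≃ₗ[ℂ] U) : U →ₗ[ℂ] U)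
      have hL : ∀ x, L (w (j x)) = 0 := by
        intro x
        have : w⁻¹ (w (j x)) = j x := by simp [← LinearEquiv.mul_apply]
        simp only [L, LinearMap.comp_apply, LinearMap.sub_apply, LinearEquiv.coe_coe,
          LinearEquiv.mul_apply, this, hjz z hz, sub_self, map_zero]
      exact ⟨linPoly b L, by simpa [L, LinearEquiv.mul_apply] using hk,
        fun _ => by simpa using hL x₀, fun _ x => by simpa using hL x⟩
  choose ρ hρ hρ0 hρr using key
  set c := ∏ w : W, ρ w
  have hc0 : evalAt b (j x₀) c ≠ 0 := by
    rw [map_prod]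
    exact Finset.prod_ne_zero_iff.mpr fun w _ => hρ w
  have hcw : ∀ w : W, w ≠ 1 → evalAt b ((w : U ≃ₗ[ℂ] U) (j x₀)) c = 0 := fun w hw => by
    rw [map_prod]
    exact Finset.prod_eq_zero (Finset.mem_univ w) (hρ0 w hw)
  refine ⟨transfer b W (c * pull b b' π t), transfer_mem_invariants _, transfer b W c,
    transfer_mem_invariants _, fun h => ?_, ?_⟩
  · have h1 := congrArg (evalAt b' x₀) h
    rw [evalAt_pull, evalAt_transfer, map_zero, Finset.sum_eq_single 1 (fun w _ hw => hcw w hw)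
      (by simp)] at h1
    exact hc0 (by simpa using h1)
  · refine ext_evalAt (b := b') fun x => ?_
    rw [map_mul, evalAt_pull, evalAt_pull, evalAt_transfer, evalAt_transfer, Finset.sum_mul]
    refine Finset.sum_congr rfl fun w _ => ?_
    rw [map_mul]
    by_cases hwr : (w : U ≃ₗ[ℂ] U) (j x₀) ∈ LinearMap.range j
    · obtain ⟨y, hy⟩ := mem_range_of_regular hZ hj hx₀ w.2 hwr x
      have h2 : π (j y) = y := LinearMap.congr_fun hπ y
      rw [evalAt_pull, ← hy, h2, ht w w.2 (fun z hz => commute_of_regular hZ hx₀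
        (fun z hz => hjz z hz x₀) w.2 ((hj _).mp hwr) hz) x y hy.symm]
    · have : evalAt b ((w : U ≃ₗ[ℂ] U) (j x)) c = 0 := by
        rw [map_prod]
        exact Finset.prod_eq_zero (Finset.mem_univ w) (hρr w hwr x)
      rw [this, zero_mul, zero_mul]

theorem mem_adjoin_of_stable [DecidableEq κ] (hZ : ∀ z ∈ Z, ∀ w ∈ W, z * w * z⁻¹ ∈ W)
    (hj : ∀ u, u ∈ LinearMap.range j ↔ ∀ z ∈ Z, z u = u)
    {x₀ : E} (hx₀ : ∀ w ∈ W, w (j x₀) = j x₀ → w = 1) (hjinj : Function.Injective j)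
    {f : κ → MvPolynomial κ ℂ} (hf : (jacobianMatrix f).det ≠ 0)
    (hfW : ∀ p ∈ invariants b W, pull b' b j p ∈ Algebra.adjoin ℂ (Set.range f))
    {t : MvPolynomial κ ℂ}
    (ht : ∀ w ∈ W, (∀ z ∈ Z, z * w = w * z) →
      ∀ x y, w (j x) = j y → evalAt b' y t = evalAt b' x t) :
    t ∈ Algebra.adjoin ℂ (Set.range f) := by
  obtain ⟨π, hπ⟩ := j.exists_leftInverse_of_injective (LinearMap.ker_eq_bot.mpr hjinj)
  obtain ⟨r₁, hr₁, r₂, hr₂, hne, h⟩ := exists_mul_eq_of_stable (b := b) hZ hj hx₀ hπ ht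
  have hclosed : IsIntegrallyClosed (Algebra.adjoin ℂ (Set.range f)) :=
    IsIntegrallyClosed.of_equiv
      (algebraicIndependent_of_jacobian_ne_zero hf).aevalEquiv.toRingEquiv
  obtain ⟨y, hy⟩ := mem_of_isIntegral_of_mul_mem (isIntegral_of_stable hfW hπ t)
    (a := ⟨_, hfW _ hr₂⟩) (c := ⟨_, hfW _ hr₁⟩) (fun h => hne (congrArg Subtype.val h)) h
  exact hy ▸ y.2

end Stable

section Codimension

variable {E κ α : Type*} [AddCommGroup E] [Module ℂ E] [Fintype κ] {b : Basis κ ℂ E} [Finite α]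
  {M : α → Submodule ℂ E}

theorem eq_zero_of_evalAt_eq_zero_off (hM : ∀ a, M a ≠ ⊤) {p : MvPolynomial κ ℂ}
    (h : ∀ v, (∀ a, v ∉ M a) → evalAt b v p = 0) : p = 0 := by
  have := Fintype.ofFinite α
  choose L hL hLM using fun a =>
    Submodule.exists_le_ker_of_lt_top (M a) (lt_top_iff_ne_top.mpr (hM a))
  have h1 : p * ∏ a, linPoly b (L a) = 0 := by
    refine ext_evalAt (b := b) fun v => ?_
    rw [map_mul, map_prod, map_zero]
    by_cases hv : ∀ a, v ∉ M a
    · rw [h v hv, zero_mul]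
    · push Not at hv
      obtain ⟨a, ha⟩ := hv
      rw [Finset.prod_eq_zero (Finset.mem_univ a) (by simpa using hLM a ha), mul_zero]
  exact (mul_eq_zero.mp h1).resolve_right
    (Finset.prod_ne_zero_iff.mpr fun a _ => linPoly_ne_zero b (hL a))

theorem exists_notMem_of_ne_top (b : Basis κ ℂ E) (hM : ∀ a, M a ≠ ⊤) : ∃ v, ∀ a, v ∉ M a := by
  by_contra! h
  have := eq_zero_of_evalAt_eq_zero_off (b := b) hM (p := 1) fun v hv => by
    obtain ⟨a, ha⟩ := h v
    exact absurd ha (hv a)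
  exact one_ne_zero this

theorem evalAt_add_eq_of_line (v u : E) {p : MvPolynomial κ ℂ}
    (h : ∀ t : ℂ, evalAt b (v + t • u) p ≠ 0) : evalAt b (v + u) p = evalAt b v p := by
  let P : Polynomial ℂ := aeval (fun i => Polynomial.C (b.equivFun v i) +
    Polynomial.X * Polynomial.C (b.equivFun u i)) p
  have hP : ∀ t, P.eval t = evalAt b (v + t • u) p := by
    intro t
    change Polynomial.evalRingHom t (aeval _ p) = _
    rw [← Polynomial.coe_aeval_eq_evalRingHom, RingHom.coe_coe, comp_aeval_apply, evalAt]
    congr 2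
    ext i
    simpa using mul_comm _ _
  have hdeg : P.degree = 0 := by
    by_contra hdeg
    obtain ⟨t, ht⟩ := IsAlgClosed.exists_root P hdeg
    exact h t (by rw [← hP]; exact ht)
  have h0 := hP 0
  have h1 := hP 1
  rw [Polynomial.eq_C_of_degree_eq_zero hdeg, Polynomial.eval_C] at h0 h1
  rw [zero_smul, add_zero] at h0
  rw [one_smul] at h1
  rw [← h0, ← h1]

/-- A polynomial function vanishing nowhere off a set of codimension at least two is constant. -/
theorem eq_C_of_evalAt_ne_zero_off (hM : ∀ a u, M a ⊔ Submodule.span ℂ {u} ≠ ⊤)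
    {p : MvPolynomial κ ℂ} (h : ∀ v, (∀ a, v ∉ M a) → evalAt b v p ≠ 0) :
    p = C (evalAt b 0 p) := by
  refine ext_evalAt (b := b) fun u => ?_
  let q : MvPolynomial κ ℂ := aeval (fun i => X i + C (b.equivFun u i)) p
  have hq : ∀ v, evalAt b v q = evalAt b (v + u) p := by
    intro v
    change evalAt b v (aeval _ p) = _
    rw [comp_aeval_apply, evalAt, evalAt]
    congr 2
    ext i
    simp
  have h0 : q - p = 0 := by
    refine eq_zero_of_evalAt_eq_zero_off (b := b) (M := fun a => M a ⊔ Submodule.span ℂ {u})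
      (fun a => hM a u) fun v hv => ?_
    rw [map_sub, hq, evalAt_add_eq_of_line v u, sub_self]
    refine fun t => h _ fun a ha => hv a ?_
    rw [← add_sub_cancel_right v (t • u)]
    exact sub_mem (Submodule.mem_sup_left ha)
      (Submodule.mem_sup_right (Submodule.smul_mem _ _ (Submodule.mem_span_singleton_self u)))
  have h1 := hq 0
  rw [sub_eq_zero.mp h0, zero_add] at h1
  rw [evalAt_C, h1]

theorem dvd_of_locally_dvd (hM : ∀ a u, M a ⊔ Submodule.span ℂ {u} ≠ ⊤)
    {p q : MvPolynomial κ ℂ} (hp : p ≠ 0)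
    (h : ∀ v, (∀ a, v ∉ M a) → ∃ r, evalAt b v r ≠ 0 ∧ p ∣ r * q) : p ∣ q := by
  obtain ⟨p', q', c, hrel, rfl, rfl⟩ := UniqueFactorizationMonoid.exists_reduced_factors p hp q
  have hp' : p' = C (evalAt b 0 p') := by
    refine eq_C_of_evalAt_ne_zero_off hM fun v hv => ?_
    obtain ⟨r, hr, hdvd⟩ := h v hv
    rw [mul_left_comm] at hdvd
    obtain ⟨s, hs⟩ := hrel.dvd_of_dvd_mul_right
      ((mul_dvd_mul_iff_left (left_ne_zero_of_mul hp)).mp hdvd)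
    rw [hs, map_mul] at hr
    exact left_ne_zero_of_mul hr
  have h0 : evalAt b 0 p' ≠ 0 := fun h0 => by
    rw [h0, C_0] at hp'
    exact hp (by rw [hp', mul_zero])
  refine mul_dvd_mul_left c ?_
  rw [hp']
  exact ((isUnit_iff_ne_zero.mpr h0).map C).dvd

end Codimension

section Converse

theorem Derivation.dvd_eval_sub {T : Type*} [CommRing T] [Algebra ℂ T] (D : Derivation ℂ T T)
    (F : Polynomial T) {δ : T} (hF : ∀ n, δ ∣ D (F.coeff n)) (x : T) :
    δ ∣ D (F.eval x) - F.derivative.eval x * D x := by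
  rw [Polynomial.derivative_eval, Polynomial.eval_eq_sum, Polynomial.sum, Polynomial.sum, map_sum,
    Finset.sum_mul, ← Finset.sum_sub_distrib]
  refine Finset.dvd_sum fun n _ => ?_
  rw [D.leibniz, D.leibniz_pow]
  obtain ⟨c, hc⟩ := hF n
  refine ⟨c * x ^ n, ?_⟩
  rw [hc]
  simp only [smul_eq_mul, nsmul_eq_mul]
  ring

variable {E κ : Type*} [AddCommGroup E] [Module ℂ E] [Fintype κ] {b : Basis κ ℂ E}
  {G H : Subgroup (E ≃ₗ[ℂ] E)} [Fintype G] {f : κ → MvPolynomial κ ℂ}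

/-- An invariant of `H` separating a point from the translates of that point not in its
`H`-orbit. -/
theorem exists_invariant_separating [Fintype H] (hHG : H ≤ G) {v : E}
    (hv : ∀ g ∈ G, g v = v → g ∈ H) :
    ∃ p ∈ invariants b H, evalAt b v p ≠ 0 ∧ ∀ g ∈ G, g ∉ H → evalAt b (g v) p = 0 := by
  obtain ⟨q, hq, hq0⟩ := exists_separating b (v := v) (s := {u | ∃ g ∈ G, g v = u ∧ u ≠ v})
    ((Set.finite_range fun g : G => (g : E ≃ₗ[ℂ] E) v).subset fun u ⟨g, hg, h, _⟩ => ⟨⟨g, hg⟩, h⟩)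
    (fun ⟨_, _, _, h⟩ => h rfl)
  refine ⟨transfer b H q, transfer_mem_invariants q, ?_, fun g hg hgH => ?_⟩
  · classical
    have h1 : ∀ h : H, evalAt b ((h : E ≃ₗ[ℂ] E) v) q =
        if (h : E ≃ₗ[ℂ] E) v = v then 1 else 0 := by
      intro h
      split_ifs with h1
      · rw [h1, hq]
      · exact hq0 _ ⟨h, hHG h.2, rfl, h1⟩
    rw [evalAt_transfer, Finset.sum_congr rfl fun h _ => h1 h, Finset.sum_boole, Nat.cast_ne_zero]
    exact Finset.card_ne_zero_of_mem (a := 1) (by simp)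
  · rw [evalAt_transfer]
    refine Finset.sum_eq_zero fun h _ => ?_
    have hm : (h : E ≃ₗ[ℂ] E) * g ∈ G := mul_mem (hHG h.2) hg
    refine hq0 _ ⟨_, hm, rfl, fun heq => hgH ?_⟩
    exact (Subgroup.mul_mem_cancel_left H h.2).mp (hv _ hm heq)

variable [DecidableEq κ]

theorem jacobian_dvd_of_separating (hG : invariants b G ≤ Algebra.adjoin ℂ (Set.range f))
    {v : E} {p : MvPolynomial κ ℂ} (hp : p ∈ invariants b H)
    (hsep : ∀ g ∈ G, g ∉ H → evalAt b (g v) p ≠ evalAt b v p) (i : κ) :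
    ∃ r, evalAt b v r ≠ 0 ∧ (jacobianMatrix f).det ∣ r * adjDeriv f i p := by
  classical
  set F := ∏ q ∈ orbitFinset b G p, (Polynomial.X - Polynomial.C q) with hF
  have hsplit := Finset.mul_prod_erase (orbitFinset b G p)
    (fun q => Polynomial.X - Polynomial.C q) (self_mem_orbitFinset b G p)
  have hdvd := (adjDeriv f i).dvd_eval_sub F (δ := (jacobianMatrix f).det) (fun n => by
    have h := hG (coeff_prod_orbit_mem_invariants b G p n)
    rw [Algebra.adjoin_range_eq_range_aeval] at h
    obtain ⟨Q, hQ⟩ := h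
    rw [← hF] at hQ
    rw [← hQ]
    exact ⟨_, adjDeriv_aeval f i Q⟩) p
  rw [hF, ← hsplit] at hdvd
  simp only [Polynomial.derivative_mul, Polynomial.eval_mul, Polynomial.eval_add,
    Polynomial.derivative_sub, Polynomial.derivative_X, Polynomial.derivative_C, sub_zero,
    Polynomial.eval_sub, Polynomial.eval_X, Polynomial.eval_C, sub_self, zero_mul, map_zero,
    add_zero, one_mul, zero_sub, dvd_neg, Polynomial.eval_prod] at hdvd
  refine ⟨_, ?_, hdvd⟩
  rw [map_prod, Finset.prod_ne_zero_iff]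
  intro q hq
  obtain ⟨hne, hq⟩ := Finset.mem_erase.mp hq
  obtain ⟨g, hg, rfl⟩ := (mem_orbitFinset b G).mp hq
  rw [map_sub, sub_ne_zero, evalAt_pull]
  exact (hsep g hg fun hgH => hne (hp g hgH)).symm

theorem jacobian_dvd_locally [Fintype H] (hHG : H ≤ G)
    (hG : invariants b G ≤ Algebra.adjoin ℂ (Set.range f)) {v : E}
    (hv : ∀ g ∈ G, g v = v → g ∈ H) {p : MvPolynomial κ ℂ} (hp : p ∈ invariants b H) (i : κ) :
    ∃ r, evalAt b v r ≠ 0 ∧ (jacobianMatrix f).det ∣ r * adjDeriv f i p := by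
  obtain ⟨p₀, hp₀, hne, h0⟩ := exists_invariant_separating (b := b) hHG hv
  obtain ⟨c, hc⟩ := ((Set.finite_range fun g : G =>
    (evalAt b ((g : E ≃ₗ[ℂ] E) v) p - evalAt b v p) / evalAt b v p₀).infinite_compl).nonempty
  obtain ⟨r₀, hr₀, hd₀⟩ := jacobian_dvd_of_separating (f := f) hG hp₀ (v := v)
    (fun g hg hgH => by rw [h0 g hg hgH]; exact hne.symm) i
  obtain ⟨r₁, hr₁, hd₁⟩ := jacobian_dvd_of_separating (f := f) hG
    (add_mem hp (Subalgebra.smul_mem _ hp₀ c)) (v := v)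
    (fun g hg hgH heq => hc ⟨⟨g, hg⟩, by
      simp only [map_add, map_smul, h0 g hg hgH, smul_eq_mul, mul_zero, add_zero] at heq
      rw [div_eq_iff hne, heq, add_sub_cancel_left]⟩) i
  refine ⟨r₀ * r₁, by simp [hr₀, hr₁], ?_⟩
  rw [map_add, Derivation.map_smul, smul_eq_C_mul] at hd₁
  have h2 : r₀ * r₁ * adjDeriv f i p =
      r₀ * (r₁ * (adjDeriv f i p + C c * adjDeriv f i p₀)) -
        C c * r₁ * (r₀ * adjDeriv f i p₀) := by ring
  rw [h2]
  exact dvd_sub (hd₁.mul_left _) (hd₀.mul_left _)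

theorem mem_span_of_jacobian_dvd {d : κ → ℕ} (hf : (jacobianMatrix f).det ≠ 0)
    (hd : ∀ i, (f i).IsHomogeneous (d i)) {p : MvPolynomial κ ℂ} {n : ℕ} (hn : 0 < n)
    (hp : p.IsHomogeneous n) (h : ∀ i, (jacobianMatrix f).det ∣ adjDeriv f i p) :
    p ∈ Ideal.span (Set.range f) := by
  choose c hc using h
  have h1 : ∀ k, pderiv k p = ∑ i, pderiv k (f i) * c i := fun k => by
    refine mul_left_cancel₀ hf ?_
    rw [← sum_pderiv_mul_adjDeriv, Finset.mul_sum]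
    exact Finset.sum_congr rfl fun i _ => by rw [hc, mul_left_comm]
  have h2 : n • p = ∑ i, c i * (d i • f i) := by
    rw [← hp.sum_X_mul_pderiv]
    simp only [h1, ← (hd _).sum_X_mul_pderiv, Finset.mul_sum]
    rw [Finset.sum_comm]
    exact Finset.sum_congr rfl fun i _ => Finset.sum_congr rfl fun k _ => by ring
  have h3 : n • p ∈ Ideal.span (Set.range f) := by
    rw [h2]
    exact sum_mem fun i _ => Ideal.mul_mem_left _ _
      (nsmul_mem (Ideal.subset_span (Set.mem_range_self i)) _)
  rw [← Nat.cast_smul_eq_nsmul ℂ] at h3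
  have h4 := Submodule.smul_of_tower_mem (Ideal.span (Set.range f)) (n : ℂ)⁻¹ h3
  rwa [inv_smul_smul₀ (by simpa using hn.ne')] at h4

/-- Converse of the Shephard-Todd theorem: a finite linear group whose invariants are generated
by a square system of homogeneous polynomials with nonzero Jacobian is generated by reflections. -/
theorem mem_closure_reflections [FiniteDimensional ℂ E] {d : κ → ℕ}
    (hf : (jacobianMatrix f).det ≠ 0)
    (hd : ∀ i, (f i).IsHomogeneous (d i)) (hd0 : ∀ i, 0 < d i) (hfG : ∀ i, f i ∈ invariants b G)
    (hG : invariants b G ≤ Algebra.adjoin ℂ (Set.range f)) {g : E ≃ₗ[ℂ] E} (hg : g ∈ G) :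
    g ∈ Subgroup.closure {r : E ≃ₗ[ℂ] E | IsReflection r ∧ r ∈ G} := by
  set H := Subgroup.closure {r : E ≃ₗ[ℂ] E | IsReflection r ∧ r ∈ G}
  have hHG : H ≤ G := (Subgroup.closure_le G).mpr fun r hr => hr.2
  have : Finite H := Finite.of_injective _ (Subgroup.inclusion_injective hHG)
  have := Fintype.ofFinite H
  let M : {g : G // (g : E ≃ₗ[ℂ] E) ∉ H} → Submodule ℂ E := fun g =>
    LinearMap.ker ((((g : G) : E ≃ₗ[ℂ] E) : E →ₗ[ℂ] E) - LinearMap.id)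
  have hmem : ∀ g v, v ∈ M g ↔ ((g : G) : E ≃ₗ[ℂ] E) v = v := fun g v => by
    simp [M, sub_eq_zero]
  have hMtop : ∀ g, M g ≠ ⊤ := fun g h => g.2 <| by
    have : ((g : G) : E ≃ₗ[ℂ] E) = 1 :=
      LinearEquiv.ext fun v => (hmem g v).mp (h ▸ Submodule.mem_top)
    rw [this]
    exact one_mem H
  have hM : ∀ g u, M g ⊔ Submodule.span ℂ {u} ≠ ⊤ := by
    intro g u h
    have h1 : finrank ℂ (M g) + 1 ≠ finrank ℂ E := fun h =>
      g.2 (Subgroup.subset_closure ⟨h, g.1.2⟩)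
    have h2 := Submodule.finrank_lt (hMtop g)
    have h3 := Submodule.finrank_add_le_finrank_add_finrank (M g) (Submodule.span ℂ {u})
    have h4 := finrank_span_le_card (R := ℂ) ({u} : Set E)
    rw [Set.toFinset_singleton, Finset.card_singleton] at h4
    rw [h, finrank_top] at h3
    omega
  have hv : ∀ v, (∀ g, v ∉ M g) → ∀ g ∈ G, g v = v → g ∈ H := fun v hv g hg hgv => by
    by_contra hgH
    exact hv ⟨⟨g, hg⟩, hgH⟩ ((hmem ⟨⟨g, hg⟩, hgH⟩ v).mpr hgv)
  have hfA : Algebra.adjoin ℂ (Set.range f) ≤ invariants b G :=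
    Algebra.adjoin_le (by rintro _ ⟨i, rfl⟩; exact hfG i)
  have hHinv : invariants b H ≤ invariants b G :=
    (invariants_le_adjoin (fun i => invariants_anti hHG (hfG i)) hd hd0 fun n hn p hp hpn =>
      mem_span_of_jacobian_dvd hf hd hn hpn fun i => dvd_of_locally_dvd hM hf fun v hvM =>
        jacobian_dvd_locally hHG hG (hv v hvM) hp i).trans hfA
  obtain ⟨v, hvM⟩ := exists_notMem_of_ne_top b hMtop
  obtain ⟨p, hp, hne, h0⟩ := exists_invariant_separating (b := b) hHG (hv v hvM)
  by_contra hgH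
  refine hne ?_
  rw [← mem_invariants_iff_evalAt.mp (hHinv hp) g hg v]
  exact h0 g hg hgH

end Converse

end ReflectionInvariants

section Springer

variable {U : Type*} [AddCommGroup U] [Module ℂ U]

theorem mem_fixedSubmodule {τ : U ≃ₗ[ℂ] U} {v : U} : v ∈ fixedSubmodule τ ↔ τ v = v := by
  simp [fixedSubmodule, sub_eq_zero]

/-- The image of the centralizer of `τ` in the general linear group of the fixed space. -/
def centralizerImage (W : Subgroup (U ≃ₗ[ℂ] U)) (τ : U ≃ₗ[ℂ] U) :
    Subgroup (fixedSubmodule τ ≃ₗ[ℂ] fixedSubmodule τ) where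
  carrier := {g | ∃ w ∈ W, τ * w = w * τ ∧ ∀ x : fixedSubmodule τ, (g x : U) = w x}
  one_mem' := ⟨1, one_mem W, by simp, fun x => rfl⟩
  mul_mem' := by
    rintro g g' ⟨w, hw, hτ, h⟩ ⟨w', hw', hτ', h'⟩
    refine ⟨w * w', mul_mem hw hw', Commute.mul_right hτ hτ', fun x => ?_⟩
    rw [LinearEquiv.mul_apply, h, h', LinearEquiv.mul_apply]
  inv_mem' := by
    rintro g ⟨w, hw, hτ, h⟩
    refine ⟨w⁻¹, inv_mem hw, Commute.inv_right hτ, fun x => w.injective ?_⟩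
    rw [← h, ← LinearEquiv.mul_apply, ← LinearEquiv.mul_apply, mul_inv_cancel, mul_inv_cancel]
    rfl

instance (W : Subgroup (U ≃ₗ[ℂ] U)) [Finite W] (τ : U ≃ₗ[ℂ] U) :
    Finite (centralizerImage W τ) := by
  choose w hw _ h using fun g : centralizerImage W τ => g.2
  refine Finite.of_injective (fun g => (⟨w g, hw g⟩ : W)) fun g g' hgg' => ?_
  have : w g = w g' := congrArg Subtype.val hgg'
  exact Subtype.ext (LinearEquiv.ext fun x => Subtype.ext (by rw [h, h, this]))

theorem exists_mem_centralizerImage {W : Subgroup (U ≃ₗ[ℂ] U)} {τ w : U ≃ₗ[ℂ] U} (hw : w ∈ W)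
    (hτ : τ * w = w * τ) :
    ∃ g ∈ centralizerImage W τ, ∀ x : fixedSubmodule τ, (g x : U) = w x := by
  have h : ∀ w : U ≃ₗ[ℂ] U, τ * w = w * τ → ∀ x ∈ fixedSubmodule τ, w x ∈ fixedSubmodule τ := by
    intro w hτ x hx
    rw [mem_fixedSubmodule] at hx ⊢
    rw [← LinearEquiv.mul_apply, hτ, LinearEquiv.mul_apply, hx]
  let g : fixedSubmodule τ ≃ₗ[ℂ] fixedSubmodule τ := LinearEquiv.ofLinearMap
    ((w : U →ₗ[ℂ] U).restrict (h w hτ))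
    (((w⁻¹ : U ≃ₗ[ℂ] U) : U →ₗ[ℂ] U).restrict (h w⁻¹ (Commute.inv_right hτ)))
    (by
      ext x
      change w (w⁻¹ x) = x
      rw [← LinearEquiv.mul_apply, mul_inv_cancel]
      rfl)
    (by
      ext x
      change w⁻¹ (w x) = x
      rw [← LinearEquiv.mul_apply, inv_mul_cancel]
      rfl)
  exact ⟨g, ⟨w, hw, hτ, fun _ => rfl⟩, fun _ => rfl⟩

end Springer

/-- (Springer) If `τ` is a regular element normalizing the complex reflection group `W`,
then `W^τ` acts faithfully on `V^τ` and its image in `GL(V^τ)` is generated by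
reflections of `V^τ`. -/
theorem stmt0 (W : Subgroup (V ≃ₗ[ℂ] V)) [Finite W]
    (hW : Subgroup.closure {g : V ≃ₗ[ℂ] V | g ∈ W ∧ IsReflection g} = W)
    (τ : V ≃ₗ[ℂ] V) (hτfin : IsOfFinOrder τ)
    (hnorm : ∀ g : V ≃ₗ[ℂ] V, g ∈ W ↔ τ * g * τ⁻¹ ∈ W)
    (hreg : ∃ v ∈ VReg W, τ v = v) :
    (∀ w ∈ W, τ * w = w * τ → (∀ v : V, τ v = v → w v = v) → w = 1) ∧
    (∀ g : (fixedSubmodule τ) ≃ₗ[ℂ] (fixedSubmodule τ),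
      (∃ w ∈ W, τ * w = w * τ ∧ ∀ x : fixedSubmodule τ, (g x : V) = w x) →
      g ∈ Subgroup.closure {r : (fixedSubmodule τ) ≃ₗ[ℂ] (fixedSubmodule τ) |
        IsReflection r ∧
          ∃ w ∈ W, τ * w = w * τ ∧ ∀ x : fixedSubmodule τ, (r x : V) = w x}) := by
  classical
  obtain ⟨v, hv, hτv⟩ := hreg
  refine ⟨fun w hw _ h => hv w hw (h v hτv), fun g hg => ?_⟩
  have := Fintype.ofFinite W
  have := Fintype.ofFinite (centralizerImage W τ)
  have : Finite (Subgroup.zpowers τ) := hτfin.finite_zpowers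
  have := Fintype.ofFinite (Subgroup.zpowers τ)
  have hZ : ∀ z ∈ Subgroup.zpowers τ, ∀ w ∈ W, z * w * z⁻¹ ∈ W := fun z hz w hw =>
    (Subgroup.mem_normalizer_iff.mp
      ((Subgroup.zpowers_le (H := Subgroup.normalizer W)).mpr
        (Subgroup.mem_normalizer_iff.mpr hnorm) hz) w).mp hw
  have hj : ∀ u, u ∈ LinearMap.range (fixedSubmodule τ).subtype ↔
      ∀ z ∈ Subgroup.zpowers τ, z u = u := by
    intro u
    rw [Submodule.range_subtype, mem_fixedSubmodule]
    exact ⟨fun h z hz => (Subgroup.zpowers_le (H := MulAction.stabilizer (V ≃ₗ[ℂ] V) u)).mpr h hz,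
      fun h => h τ (Subgroup.mem_zpowers τ)⟩
  let x₀ : fixedSubmodule τ := ⟨v, mem_fixedSubmodule.mpr hτv⟩
  have hx₀ : ∀ w ∈ W, w ((fixedSubmodule τ).subtype x₀) = (fixedSubmodule τ).subtype x₀ → w = 1 :=
    hv
  have hinj := (fixedSubmodule τ).subtype_injective
  obtain ⟨f, d, hd, hd0, hfW, hWf, hind⟩ := exists_restricted_invariants (b := finBasis ℂ V)
    (b' := finBasis ℂ (fixedSubmodule τ)) hW hZ hinj hj hx₀
  have hjac := jacobian_ne_zero hind
  refine mem_closure_reflections (b := finBasis ℂ (fixedSubmodule τ)) (G := centralizerImage W τ)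
    hjac hd hd0 (fun i => ?_) (fun t ht => ?_) hg
  · obtain ⟨p, hp, hfp⟩ := hfW i
    rw [hfp, mem_invariants_iff_evalAt]
    rintro g ⟨w, hw, -, h⟩ x
    rw [evalAt_pull, evalAt_pull, Submodule.subtype_apply, h]
    exact mem_invariants_iff_evalAt.mp hp w hw x
  · refine mem_adjoin_of_stable hZ hj hx₀ hinj hjac hWf fun w hw hwτ x y hxy => ?_
    obtain ⟨g, hg, hgw⟩ := exists_mem_centralizerImage hw (hwτ τ (Subgroup.mem_zpowers τ))
    rw [← mem_invariants_iff_evalAt.mp ht g hg x]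
    congr 2
    exact Subtype.ext (hxy.symm.trans (hgw x).symm)
end
end

section
/- Let E be a finite-dimensional complex vector space, I a finite index set, and (E_i)_{i ∈ I} a family of subspaces such that E is the internal direct sum of the E_i. Let g be an endomorphism of E and σ a permutation of I such that g(E_i) ⊆ E_{σ(i)} for all i ∈ I. If the trace of g is nonzero, then there exists i ∈ I with σ(i) = i and E_i ≠ 0. -/
open Module

/-- If `E` is the internal direct sum of subspaces `E_i`, `g` is an endomorphism permuting
the subspaces along a permutation `σ` of the (finite) index set, and `g` has nonzero trace,
then some `E_i` with `σ(i) = i` is nonzero. -/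
theorem stmt10 {E : Type*} [AddCommGroup E] [Module ℂ E] [FiniteDimensional ℂ E]
    {I : Type*} [Fintype I] (p : I → Submodule ℂ E)
    (hind : iSupIndep p) (hsup : ⨆ i, p i = ⊤)
    (g : E →ₗ[ℂ] E) (σ : Equiv.Perm I)
    (hmap : ∀ i, (p i).map g ≤ p (σ i))
    (htr : LinearMap.trace ℂ E g ≠ 0) :
    ∃ i, σ i = i ∧ p i ≠ ⊥ := by
  classical
  by_contra! hfix
  refine htr ?_
  by_cases hbot : ∀ i, p i = ⊥
  · have htop : (⊤ : Submodule ℂ E) = ⊥ := by rw [← hsup]; simp [hbot]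
    have hg : g = 0 := by
      ext x
      have hx : x ∈ (⊥ : Submodule ℂ E) := htop ▸ Submodule.mem_top
      simp [(Submodule.mem_bot ℂ).mp hx]
    simp [hg]
  · obtain ⟨j, hj⟩ := not_forall.mp hbot
    -- A fixed index has zero summand, so it may be sent to `j` instead.
    refine LinearMap.trace_eq_zero_of_mapsTo_ne
      (DirectSum.isInternal_submodule_of_iSupIndep_of_iSup_eq_top hind hsup)
      (fun i => if σ i = i then j else σ i) (fun i => ?_) (fun i x hx => ?_)
    · by_cases h : σ i = i
      · simp only [h, if_true]
        rintro rfl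
        exact hj (hfix _ h)
      · simp [h]
    · by_cases h : σ i = i
      · have hx0 : x = 0 := by simpa [hfix i h] using hx
        simp [hx0]
      · simpa [h] using hmap i (Submodule.mem_map_of_mem hx)
end

section
/- Let V and E be finite-dimensional complex vector spaces with E ≠ 0, let τ ∈ GL(V), let D : V → End(E) be a linear map whose values pairwise commute, and let g ∈ GL(E) satisfy g ∘ D(y) ∘ g⁻¹ = D(τ(y)) for all y ∈ V. If the trace of g is nonzero, then there exists a linear form ξ ∈ V* with ξ ∘ τ = ξ such that the joint generalized eigenspace {m ∈ E : (D(y) − ξ(y)·id)^{dim E}(m) = 0 for all y ∈ V} is nonzero. -/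
open Module

noncomputable section

/-- The joint generalized eigenspace of a family of operators for the system of
eigenvalues given by the linear form `ξ`. -/
def jointGenEigenspace {V E : Type*} [AddCommGroup V] [Module ℂ V]
    [AddCommGroup E] [Module ℂ E]
    (D : V → Module.End ℂ E) (ξ : Module.Dual ℂ V) : Submodule ℂ E :=
  ⨅ y : V, LinearMap.ker ((D y - ξ y • (1 : Module.End ℂ E)) ^ finrank ℂ E)
namespace Module.End

variable {ι K M : Type*} [Field K] [AddCommGroup M] [Module K M]

lemma mapsTo_iInf_maxGenEigenspace_of_commute {f : ι → End K M} (hf : ∀ i j, Commute (f i) (f j))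
    (χ : ι → K) (i : ι) :
    Set.MapsTo (f i) (⨅ j, (f j).maxGenEigenspace (χ j) : Submodule K M)
      (⨅ j, (f j).maxGenEigenspace (χ j) : Submodule K M) := by
  intro m hm
  simp only [SetLike.mem_coe, Submodule.mem_iInf] at hm ⊢
  exact fun j => mapsTo_maxGenEigenspace_of_comm (hf j i) (χ j) (hm j)

/-- The trace of `f i` on a joint generalized eigenspace is its eigenvalue times the dimension. -/
lemma trace_restrict_iInf_maxGenEigenspace [FiniteDimensional K M] {f : ι → End K M}
    (hf : ∀ i j, Commute (f i) (f j)) (χ : ι → K) (i : ι) :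
    LinearMap.trace K _ ((f i).restrict (mapsTo_iInf_maxGenEigenspace_of_commute hf χ i)) =
      χ i * finrank K (⨅ j, (f j).maxGenEigenspace (χ j) : Submodule K M) := by
  have hmaps := mapsTo_iInf_maxGenEigenspace_of_commute hf χ i
  set N : Submodule K M := ⨅ j, (f j).maxGenEigenspace (χ j)
  have hsub : Set.MapsTo (f i - algebraMap K (End K M) (χ i)) N N := fun m hm =>
    N.sub_mem (hmaps hm) (N.smul_mem _ hm)
  have hnil : IsNilpotent ((f i - algebraMap K (End K M) (χ i)).restrict hsub) :=
    isNilpotent_restrict_of_le (iInf_le _ i)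
      (isNilpotent_restrict_maxGenEigenspace_sub_algebraMap (f i) (χ i))
  have heq : (f i).restrict hmaps =
      (f i - algebraMap K (End K M) (χ i)).restrict hsub + χ i • LinearMap.id := by
    ext m
    exact (sub_add_cancel (f i m) (χ i • (m : M))).symm
  rw [heq, map_add, (LinearMap.isNilpotent_trace_of_isNilpotent hnil).eq_zero, map_smul,
    LinearMap.trace_id, zero_add, smul_eq_mul]

lemma isInternal_iInf_maxGenEigenspace [IsAlgClosed K] [FiniteDimensional K M]
    [DecidableEq (ι → K)] {f : ι → End K M} (hf : ∀ i j, Commute (f i) (f j)) :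
    DirectSum.IsInternal fun χ : ι → K => ⨅ i, (f i).maxGenEigenspace (χ i) := by
  rw [DirectSum.isInternal_submodule_iff_iSupIndep_and_iSup_eq_top]
  exact ⟨independent_iInf_maxGenEigenspace_of_forall_mapsTo f
      fun i j φ => mapsTo_maxGenEigenspace_of_comm (hf j i) φ,
    iSup_iInf_maxGenEigenspace_eq_top_of_iSup_maxGenEigenspace_eq_top_of_commute f
      (fun i j _ => hf i j) fun i => iSup_maxGenEigenspace_eq_top (f i)⟩

/-- A function whose joint generalized eigenspace is nonzero for a commuting linear family in
characteristic zero is linear. -/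
lemma exists_dual_of_iInf_maxGenEigenspace_ne_bot {W : Type*} [AddCommGroup W] [Module K W]
    [CharZero K] [FiniteDimensional K M] (D : W →ₗ[K] End K M)
    (hD : ∀ y y', Commute (D y) (D y')) {χ : W → K}
    (hχ : (⨅ y, (D y).maxGenEigenspace (χ y)) ≠ ⊥) :
    ∃ ξ : Dual K W, ⇑ξ = χ := by
  have htr := trace_restrict_iInf_maxGenEigenspace hD χ
  have hmaps := mapsTo_iInf_maxGenEigenspace_of_commute hD χ
  set N : Submodule K M := ⨅ y, (D y).maxGenEigenspace (χ y)
  have hN : (finrank K N : K) ≠ 0 := by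
    rwa [Nat.cast_ne_zero, ne_eq, Submodule.finrank_eq_zero]
  refine ⟨{ toFun := χ, map_add' := fun a b => ?_, map_smul' := fun c a => ?_ }, rfl⟩
  · have h : (D (a + b)).restrict (hmaps (a + b)) =
        (D a).restrict (hmaps a) + (D b).restrict (hmaps b) := by
      ext m
      exact congrArg (· (m : M)) (map_add D a b)
    apply mul_right_cancel₀ hN
    rw [← htr, h, map_add, htr, htr, add_mul]
  · have h : (D (c • a)).restrict (hmaps (c • a)) = c • (D a).restrict (hmaps a) := by
      ext m
      exact congrArg (· (m : M)) (map_smul D c a)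
    apply mul_right_cancel₀ hN
    rw [← htr, h, map_smul, htr, smul_eq_mul, smul_eq_mul, RingHom.id_apply, mul_assoc]

lemma mapsTo_maxGenEigenspace_of_semiconjBy {g f f' : End K M} (h : SemiconjBy g f f') (μ : K) :
    Set.MapsTo g (f.maxGenEigenspace μ) (f'.maxGenEigenspace μ) := by
  intro m hm
  simp only [SetLike.mem_coe, mem_maxGenEigenspace] at hm ⊢
  obtain ⟨k, hk⟩ := hm
  have hμ : SemiconjBy g (μ • (1 : End K M)) (μ • 1) := by
    simp [SemiconjBy]
  refine ⟨k, ?_⟩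
  rw [← mul_apply, ← ((h.sub_right hμ).pow_right k).eq, mul_apply, hk, map_zero]

end Module.End

lemma jointGenEigenspace_eq_iInf_maxGenEigenspace {V E : Type*} [AddCommGroup V] [Module ℂ V]
    [AddCommGroup E] [Module ℂ E] [FiniteDimensional ℂ E] (D : V → Module.End ℂ E)
    (ξ : Module.Dual ℂ V) :
    jointGenEigenspace D ξ = ⨅ y, (D y).maxGenEigenspace (ξ y) := by
  simp only [jointGenEigenspace, Module.End.maxGenEigenspace_eq_genEigenspace_finrank,
    Module.End.genEigenspace_nat]

/-- Let `D : V → End(E)` be a linear map with pairwise commuting values and let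
`g ∈ GL(E)` intertwine `D` with `D ∘ τ`. If `g` has nonzero trace, then there is a
`τ`-invariant linear form `ξ` on `V` whose joint generalized eigenspace is nonzero. -/
theorem stmt11 {V E : Type*} [AddCommGroup V] [Module ℂ V] [FiniteDimensional ℂ V]
    [AddCommGroup E] [Module ℂ E] [FiniteDimensional ℂ E] [Nontrivial E]
    (τ : V ≃ₗ[ℂ] V) (D : V →ₗ[ℂ] Module.End ℂ E)
    (hcomm : ∀ y y' : V, D y * D y' = D y' * D y)
    (g : E ≃ₗ[ℂ] E)
    (hg : ∀ y : V, (g : E →ₗ[ℂ] E) * D y * (g.symm : E →ₗ[ℂ] E) = D (τ y))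
    (htr : LinearMap.trace ℂ E (g : E →ₗ[ℂ] E) ≠ 0) :
    ∃ ξ : Module.Dual ℂ V, ξ ∘ₗ (τ : V →ₗ[ℂ] V) = ξ ∧
      jointGenEigenspace (fun y => D y) ξ ≠ ⊥ := by
  classical
  let N : (V → ℂ) → Submodule ℂ E := fun χ => ⨅ y, (D y).maxGenEigenspace (χ y)
  have hsemi (y : V) : SemiconjBy (g : E →ₗ[ℂ] E) (D y) (D (τ y)) := by
    ext m
    simp [← hg]
  have hgN (χ : V → ℂ) : Set.MapsTo (g : E →ₗ[ℂ] E) (N χ) (N (χ ∘ τ.symm)) := by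
    intro m hm
    simp only [N, SetLike.mem_coe, Submodule.mem_iInf] at hm ⊢
    intro y
    simpa using Module.End.mapsTo_maxGenEigenspace_of_semiconjBy (hsemi (τ.symm y)) _
      (hm (τ.symm y))
  have hne (χ : V → ℂ) (hχ : N χ ≠ ⊥) : N (χ ∘ τ.symm) ≠ ⊥ := by
    obtain ⟨m, hm, hm0⟩ := Submodule.exists_mem_ne_zero_of_ne_bot hχ
    exact (Submodule.ne_bot_iff _).2 ⟨g m, hgN χ hm, by simpa using hm0⟩
  obtain ⟨χ, hχ, hfix⟩ : ∃ χ, N χ ≠ ⊥ ∧ χ ∘ τ.symm = χ := by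
    by_contra! hcon
    exact htr <| LinearMap.trace_eq_zero_of_mapsTo_ne
      (DirectSum.isInternal_ne_bot_iff.2 (Module.End.isInternal_iInf_maxGenEigenspace hcomm))
      (fun χ : {χ // N χ ≠ ⊥} => ⟨χ.1 ∘ τ.symm, hne χ.1 χ.2⟩)
      (fun χ h => hcon χ.1 χ.2 (congrArg Subtype.val h)) (fun χ => hgN χ.1)
  obtain ⟨ξ, rfl⟩ := Module.End.exists_dual_of_iInf_maxGenEigenspace_ne_bot D hcomm hχ
  refine ⟨ξ, ?_, ?_⟩
  · ext y
    simpa using (congrFun hfix (τ y)).symm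
  · rwa [jointGenEigenspace_eq_iInf_maxGenEigenspace]
end
end

section
/- Let G be a finite group, W a normal subgroup of G, and τ ∈ G such that G is generated by W together with τ (so G/W is cyclic). Let χ be an irreducible complex character of W with χ(τwτ⁻¹) = χ(w) for all w ∈ W. Then there exists an irreducible complex character χ̃ of G whose restriction to W equals χ. -/
noncomputable section

/-- `χ : H → ℂ` is the character of an irreducible complex representation of `H`. -/
def IsIrrChar (H : Type) [Group H] (χ : H → ℂ) : Prop :=
  ∃ ρ : FDRep ℂ H, CategoryTheory.Simple ρ ∧ ∀ h : H, χ h = FDRep.character ρ h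

open CategoryTheory in
/-- **Schur's lemma**: a linear map commuting with a simple representation is a scalar. -/
theorem FDRep.exists_eq_smul_one_of_commute {k H : Type*} [Field k] [IsAlgClosed k] [Monoid H]
    (V : FDRep k H) [Simple V] (S : V →ₗ[k] V) (hS : ∀ h, Commute S (V.ρ h)) :
    ∃ c : k, S = c • 1 := by
  let f : V ⟶ V := ⟨InducedCategory.homMk (ModuleCat.ofHom S), fun h ↦
    InducedCategory.hom_ext (ModuleCat.hom_ext (hS h).eq)⟩
  obtain ⟨c, hc⟩ := endomorphism_simple_eq_smul_id k f
  exact ⟨c, congrArg (fun g : V ⟶ V ↦ g.hom.hom.hom) hc.symm⟩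

open CategoryTheory in
/-- A representation whose only commuting linear maps are scalars is simple. -/
theorem FDRep.simple_of_commute {k H : Type} [Field k] [IsAlgClosed k] [Group H] [Finite H]
    [NeZero (Nat.card H : k)] (V : FDRep k H) [Nontrivial V]
    (hV : ∀ S : V →ₗ[k] V, (∀ h, Commute S (V.ρ h)) → ∃ c : k, S = c • 1) : Simple V := by
  rw [FDRep.simple_iff_end_is_rank_one]
  refine finrank_eq_one (𝟙 V) (fun h ↦ ?_) fun f ↦ ?_
  · exact one_ne_zero (α := V →ₗ[k] V) (congrArg (fun g : V ⟶ V ↦ g.hom.hom.hom) h)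
  · obtain ⟨c, hc⟩ := hV f.hom.hom.hom fun h ↦
      congrArg (fun g : V.V ⟶ V.V ↦ g.hom.hom) (f.comm h)
    exact ⟨c, Action.Hom.ext (InducedCategory.hom_ext (ModuleCat.hom_ext hc.symm))⟩

open CategoryTheory in
/-- In characteristic zero, a representation with the same character as a simple one is isomorphic
to it. -/
theorem FDRep.nonempty_iso_of_character_eq {k H : Type} [Field k] [IsAlgClosed k] [CharZero k]
    [Group H] [Finite H] (V U : FDRep k H) [hV : Simple V] (h : V.character = U.character) :
    Nonempty (V ≅ U) := by
  classical
  have := Fintype.ofFinite H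
  have hU : Simple U := by
    rw [FDRep.simple_iff_char_is_norm_one] at hV ⊢
    rwa [← h]
  have := invertibleOfNonzero (NeZero.ne (Nat.card H : k))
  have e := FDRep.char_orthonormal V U
  by_contra hne
  rw [if_neg hne, ← h, (FDRep.simple_iff_char_is_norm_one V).1 hV,
    inv_mul_cancel_of_invertible] at e
  exact one_ne_zero e

/-- If `t` conjugates the values of `f` the way `τ` conjugates their arguments, then so do all powers
of `t` and `τ`. -/
theorem Subgroup.map_conjNormal_zpow {G M : Type*} [Group G] [Group M] {W : Subgroup G} [W.Normal]
    {τ : G} {f : W →* M} {t : M} (hconj : ∀ w, f (MulAut.conjNormal τ w) = t * f w * t⁻¹)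
    (m : ℤ) (w : W) : f (MulAut.conjNormal (τ ^ m) w) = t ^ m * f w * (t ^ m)⁻¹ := by
  induction m generalizing w with
  | zero => simp
  | succ m ih =>
    rw [zpow_add_one, map_mul, MulAut.mul_apply, ih, hconj]
    group
  | pred m ih =>
    have h : f (MulAut.conjNormal τ⁻¹ w) = t⁻¹ * f w * t := by
      have := hconj (MulAut.conjNormal τ⁻¹ w)
      rw [map_inv, MulAut.apply_inv_self] at this
      rw [this, map_inv]
      group
    rw [zpow_sub_one, map_mul, MulAut.mul_apply, ih, h]
    group

/-- Let `G` be generated by a normal subgroup `W` and an element `τ`, and let `n` be the order of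
`τ` modulo `W`. A homomorphism `f` on `W` extends to `G` as soon as some element `t` of the target
satisfies the relations that an image of `τ` has to satisfy. -/
theorem Subgroup.exists_extension_of_closure_union_singleton {G M : Type*} [Group G] [Group M]
    (W : Subgroup G) [W.Normal] (τ : G) (hgen : Subgroup.closure ((W : Set G) ∪ {τ}) = ⊤)
    (f : W →* M) (t : M) (hconj : ∀ w, f (MulAut.conjNormal τ w) = t * f w * t⁻¹)
    (u : W) (hu : (u : G) = τ ^ orderOf (τ : G ⧸ W)) (ht : t ^ orderOf (τ : G ⧸ W) = f u) :
    ∃ F : G →* M, ∀ w : W, F w = f w := by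
  let φ : Multiplicative ℤ →* MulAut W := zpowersHom _ (MulAut.conjNormal τ)
  let p : W ⋊[φ] Multiplicative ℤ →* G :=
    SemidirectProduct.lift W.subtype (zpowersHom G τ) fun m ↦ by
      ext w
      simp [φ, ← map_zpow]
  let q : W ⋊[φ] Multiplicative ℤ →* M :=
    SemidirectProduct.lift f (zpowersHom M t) fun m ↦ by
      ext w
      simp [φ, map_conjNormal_zpow hconj, ← map_zpow]
  have hp : Function.Surjective p := by
    rw [← MonoidHom.range_eq_top, eq_top_iff, ← hgen, Subgroup.closure_le]
    rintro x (hx | rfl)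
    · exact ⟨SemidirectProduct.inl ⟨x, hx⟩, by simp [p]⟩
    · exact ⟨SemidirectProduct.inr (Multiplicative.ofAdd 1), by simp [p]⟩
  have hpq : p.ker ≤ q.ker := by
    rintro ⟨w, m⟩ h
    have h : (w : G) * τ ^ m.toAdd = 1 := h
    change f w * t ^ m.toAdd = 1
    have hm : (τ : G ⧸ W) ^ m.toAdd = 1 := by
      rw [← QuotientGroup.mk_zpow, QuotientGroup.eq_one_iff, eq_inv_of_mul_eq_one_right h]
      exact inv_mem w.2
    obtain ⟨d, hd⟩ := orderOf_dvd_iff_zpow_eq_one.2 hm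
    rw [hd, zpow_mul, zpow_natCast] at h ⊢
    rw [ht, ← map_zpow, ← map_mul, ← map_one f]
    congr 1
    ext
    simpa [hu] using h
  refine ⟨MonoidHom.liftOfSurjective p hp ⟨q, hpq⟩, fun w ↦ ?_⟩
  have := MonoidHom.liftOfRightInverse_comp_apply p _ (Function.rightInverse_surjInv hp) ⟨q, hpq⟩
    (SemidirectProduct.inl w)
  simpa [p, q] using this

/-- If `G` is generated by its normal subgroup `W` together with `τ` (so `G/W` is
cyclic), then every `τ`-stable irreducible character of `W` extends to an irreducible
character of `G`. -/
theorem stmt15 {G : Type} [Group G] [Fintype G] (W : Subgroup G) [W.Normal] (τ : G)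
    (hgen : Subgroup.closure ((W : Set G) ∪ {τ}) = ⊤)
    (χ : W → ℂ) (hχ : IsIrrChar W χ)
    (hst : ∀ w₁ w₂ : W, (w₂ : G) = τ * (w₁ : G) * τ⁻¹ → χ w₂ = χ w₁) :
    ∃ χ' : G → ℂ, IsIrrChar G χ' ∧ ∀ w : W, χ' (w : G) = χ w := by
  obtain ⟨V, hV, hχV⟩ := hχ
  have hV_nontrivial : Nontrivial V := by
    by_contra h
    rw [not_nontrivial_iff_subsingleton] at h
    exact CategoryTheory.id_nonzero V (Action.Hom.ext (CategoryTheory.InducedCategory.hom_ext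
      (ModuleCat.hom_ext (Subsingleton.elim (α := V →ₗ[ℂ] V) _ _))))
  let f : W →* (V →ₗ[ℂ] V)ˣ := MonoidHom.toHomUnits V.ρ
  let V' : FDRep ℂ W := FDRep.of (V.ρ.comp (MulAut.conjNormal τ : MulAut W).toMonoidHom)
  have hchar : V.character = V'.character := by
    ext w
    change _ = V.character (MulAut.conjNormal τ w)
    rw [← hχV, ← hχV, hst w _ (MulAut.conjNormal_apply τ w)]
  obtain ⟨i⟩ := V.nonempty_iso_of_character_eq V' hchar
  let e : V ≃ₗ[ℂ] V := (FDRep.isoToLinearEquiv i :)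
  let t : (V →ₗ[ℂ] V)ˣ := (LinearMap.GeneralLinearGroup.generalLinearEquiv ℂ V).symm e
  have ht (w : W) : f (MulAut.conjNormal τ w) = t * f w * t⁻¹ := by
    ext1
    exact FDRep.Iso.conj_ρ i w
  set n := orderOf (τ : G ⧸ W) with hn
  have hn_pos : 0 < n := orderOf_pos _
  have hτn : τ ^ n ∈ W := by
    rw [← QuotientGroup.eq_one_iff, QuotientGroup.mk_pow, pow_orderOf_eq_one]
  let u : W := ⟨τ ^ n, hτn⟩
  have hcomm (w : W) : Commute ((f u)⁻¹ * t ^ n) (f w) := by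
    have h := Subgroup.map_conjNormal_zpow ht n w
    rw [zpow_natCast, zpow_natCast] at h
    have hw : MulAut.conjNormal (τ ^ n) w = u * w * u⁻¹ := by
      ext
      rw [MulAut.conjNormal_apply]
      rfl
    rw [hw, map_mul, map_mul, map_inv] at h
    rw [commute_iff_eq, mul_assoc, ← eq_mul_inv_iff_mul_eq.1 h]
    group
  obtain ⟨c, hc⟩ := V.exists_eq_smul_one_of_commute _ fun w ↦ (hcomm w).map (Units.coeHom _)
  have hc0 : c ≠ 0 := by
    rintro rfl
    rw [zero_smul] at hc
    exact Units.ne_zero ((f u)⁻¹ * t ^ n) hc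
  obtain ⟨b, hb⟩ := IsAlgClosed.exists_pow_nat_eq c⁻¹ hn_pos
  have hb0 : b ≠ 0 := by
    rintro rfl
    rw [zero_pow hn_pos.ne'] at hb
    exact inv_ne_zero hc0 hb.symm
  let z : ℂˣ →* (V →ₗ[ℂ] V)ˣ := Units.map (algebraMap ℂ (V →ₗ[ℂ] V)).toMonoidHom
  have hz (a : ℂˣ) (x : (V →ₗ[ℂ] V)ˣ) : Commute (z a) x :=
    Units.ext (Algebra.commutes a.val x.val)
  have hzc : (f u)⁻¹ * t ^ n = z (Units.mk0 c hc0) :=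
    Units.ext (hc.trans (Algebra.algebraMap_eq_smul_one c).symm)
  have hzb : Units.mk0 b hb0 ^ n = (Units.mk0 c hc0)⁻¹ := Units.ext (by simpa using hb)
  obtain ⟨F, hF⟩ := W.exists_extension_of_closure_union_singleton τ hgen f
    (t * z (Units.mk0 b hb0))
    (fun w ↦ by
      rw [ht, mul_assoc t (z _), (hz _ (f w)).eq]
      group)
    u rfl (by
      rw [← hn, (hz _ t).symm.mul_pow, ← map_pow z, hzb, map_inv, ← hzc]
      group)
  let U : FDRep ℂ G := FDRep.of ((Units.coeHom (V →ₗ[ℂ] V)).comp F)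
  have hU (w : W) : U.ρ w = V.ρ w := congrArg Units.val (hF w)
  have : Nontrivial U := hV_nontrivial
  refine ⟨U.character, ⟨U, U.simple_of_commute fun S hS ↦ ?_, fun _ ↦ rfl⟩, fun w ↦ ?_⟩
  · exact V.exists_eq_smul_one_of_commute S fun w ↦ hU w ▸ hS w
  · rw [hχV]
    exact congrArg (LinearMap.trace ℂ V) (hU w)
end
end

section
/- Let n ≥ 2, d ≥ 1, and let ζ ∈ ℂ be a primitive d-th root of unity. The following are equivalent: (1) there exist a permutation w of {1, …, n} and a vector v ∈ ℂⁿ with pairwise distinct coordinates such that v_{w(i)} = ζ·v_i for all i; (2) d divides n or d divides n − 1. (In other words, d is a regular number for the symmetric group S_n acting on ℂⁿ by permutation of coordinates if and only if d | n or d | n−1.) -/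
/-- If a permutation of the indices scales a vector with no repeated coordinate by a primitive
`d`-th root of unity, then `d` divides the number of nonzero coordinates. -/
theorem IsPrimitiveRoot.dvd_card_filter_ne_zero {ι K : Type*} [Fintype ι] [Field K]
    [DecidableEq K] {d : ℕ} {ζ : K} (hζ : IsPrimitiveRoot ζ d) (hζ0 : ζ ≠ 0)
    (w : Equiv.Perm ι) (v : ι → K) (h : ∀ i, v (w i) = ζ * v i) :
    d ∣ (Finset.univ.filter fun i => v i ≠ 0).card := by
  set s := Finset.univ.filter fun i => v i ≠ 0
  have hs : ∏ i ∈ s, v i ≠ 0 := Finset.prod_ne_zero_iff.2 fun i hi => (Finset.mem_filter.1 hi).2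
  have key : ∏ i ∈ s, ζ * v i = ∏ i ∈ s, v i :=
    Finset.prod_equiv w (fun i => by simp [s, h, hζ0]) fun i _ => (h i).symm
  rw [Finset.prod_mul_distrib, Finset.prod_const] at key
  exact hζ.dvd_of_pow_eq_one _ (mul_eq_right₀ hs |>.1 key)

/-- A finite set of field elements stable under multiplication by `ζ ≠ 0` is the set of coordinates
of a `ζ`-eigenvector of some permutation. -/
theorem exists_perm_eigenvector_of_mul_mem {K : Type*} [Field K] {n : ℕ} {ζ : K} (hζ0 : ζ ≠ 0)
    (T : Finset K) (hT : T.card = n) (h : ∀ z ∈ T, ζ * z ∈ T) :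
    ∃ (w : Equiv.Perm (Fin n)) (v : Fin n → K),
      Function.Injective v ∧ ∀ i, v (w i) = ζ * v i := by
  let e := T.equivFinOfCardEq hT
  let f : T → T := fun z => ⟨ζ * z, h z z.2⟩
  have hf : Function.Injective f := fun a b hab =>
    Subtype.ext (mul_left_cancel₀ hζ0 (congrArg Subtype.val hab))
  refine ⟨(e.symm.trans (Equiv.ofBijective f (Finite.injective_iff_bijective.1 hf))).trans e,
    fun i => (e.symm i : K), Subtype.val_injective.comp e.symm.injective, fun i => ?_⟩
  simp [f]


/-- `d` is a regular number for the symmetric group `S_n` acting on `ℂⁿ` by permutation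
of the coordinates if and only if `d` divides `n` or `d` divides `n - 1`. -/
theorem stmt16 (n d : ℕ) (hn : 2 ≤ n) (hd : 1 ≤ d) (ζ : ℂ) (hζ : IsPrimitiveRoot ζ d) :
    (∃ (w : Equiv.Perm (Fin n)) (v : Fin n → ℂ),
      Function.Injective v ∧ ∀ i : Fin n, v (w i) = ζ * v i) ↔ (d ∣ n ∨ d ∣ n - 1) := by
  classical
  have hζ0 : ζ ≠ 0 := hζ.ne_zero (by omega)
  constructor
  · rintro ⟨w, v, hv, h⟩
    have hdvd := hζ.dvd_card_filter_ne_zero hζ0 w v h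
    have hadd := Finset.card_filter_add_card_filter_not (s := Finset.univ) fun i => v i ≠ 0
    have hzero : (Finset.univ.filter fun i => ¬ v i ≠ 0).card ≤ 1 :=
      Finset.card_le_one.2 fun a ha b hb => hv <| by simp_all
    rw [Finset.card_univ, Fintype.card_fin] at hadd
    obtain hc | hc : (Finset.univ.filter fun i => v i ≠ 0).card = n ∨
        (Finset.univ.filter fun i => v i ≠ 0).card = n - 1 := by omega
    · exact Or.inl (hc ▸ hdvd)
    · exact Or.inr (hc ▸ hdvd)
  · have hcard (m : ℕ) (hm : m ≠ 0) : (Polynomial.nthRootsFinset m (1 : ℂ)).card = m :=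
      (Complex.isPrimitiveRoot_exp m hm).card_nthRootsFinset
    have hmul (m : ℕ) (hm : m ≠ 0) (hdm : d ∣ m) (z : ℂ)
        (hz : z ∈ Polynomial.nthRootsFinset m (1 : ℂ)) :
        ζ * z ∈ Polynomial.nthRootsFinset m (1 : ℂ) := by
      rw [Polynomial.mem_nthRootsFinset (Nat.pos_of_ne_zero hm)] at hz ⊢
      rw [mul_pow, hz, (hζ.pow_eq_one_iff_dvd m).2 hdm, one_mul]
    rintro (hdn | hdn)
    · exact exists_perm_eigenvector_of_mul_mem hζ0 _ (hcard n (by omega))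
        (hmul n (by omega) hdn)
    · have hn1 : n - 1 ≠ 0 := by omega
      refine exists_perm_eigenvector_of_mul_mem hζ0
        (insert 0 (Polynomial.nthRootsFinset (n - 1) (1 : ℂ))) ?_ fun z hz => ?_
      · rw [Finset.card_insert_of_notMem, hcard _ hn1]
        · omega
        · simp [Polynomial.mem_nthRootsFinset (Nat.pos_of_ne_zero hn1), hn1]
      · rcases Finset.mem_insert.1 hz with rfl | hz
        · simp
        · exact Finset.mem_insert_of_mem (hmul _ hn1 hdn z hz)
end

section
/- Let n ≥ 2, d ≥ 2, let ζ ∈ ℂ be a primitive d-th root of unity, let w be a permutation of {1, …, n}, and let v ∈ ℂⁿ have pairwise distinct coordinates with v_{w(i)} = ζ·v_i for all i. Then every cycle of w has length exactly d, except for at most one fixed point; equivalently, every orbit of the cyclic group generated by w on {1, …, n} has cardinality d or 1, and at most one orbit has cardinality 1. In particular w is a product of r disjoint d-cycles where n = rd + j with j = n mod d ∈ {0, 1}. -/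
/-- Iterating `w` multiplies the coordinates of an eigenvector by powers of the eigenvalue. -/
theorem apply_iterate_eq_pow_mul {α M : Type*} [Monoid M] {w : α → α} {v : α → M} {ζ : M}
    (hwv : ∀ i, v (w i) = ζ * v i) (k : ℕ) (i : α) : v (w^[k] i) = ζ ^ k * v i := by
  induction k with
  | zero => simp
  | succ k ih => rw [Function.iterate_succ_apply', hwv, ih, pow_succ', mul_assoc]

/-- A point where the regular eigenvector does not vanish has period `d`. -/
theorem minimalPeriod_eq_of_apply_ne_zero {α K : Type*} [Field K] {d : ℕ} {ζ : K}
    (hζ : IsPrimitiveRoot ζ d) {w : α → α} {v : α → K} (hv : Function.Injective v)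
    (hwv : ∀ i, v (w i) = ζ * v i) {i : α} (hi : v i ≠ 0) :
    Function.minimalPeriod w i = d := by
  have key (k : ℕ) : Function.IsPeriodicPt w k i ↔ d ∣ k := by
    rw [← hζ.pow_eq_one_iff_dvd, Function.IsPeriodicPt, Function.IsFixedPt, ← hv.eq_iff,
      apply_iterate_eq_pow_mul hwv, mul_eq_right₀ hi]
  exact Nat.dvd_antisymm ((key d).2 dvd_rfl).minimalPeriod_dvd
    ((key _).1 (Function.isPeriodicPt_minimalPeriod w i))

/-- The nonvanishing locus of a regular eigenvector has cardinality divisible by `d`. -/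
theorem dvd_card_filter_apply_ne_zero {α K : Type*} [Fintype α] [Field K] [DecidableEq K]
    {d : ℕ} (hd : 0 < d) {ζ : K} (hζ : IsPrimitiveRoot ζ d) {w : α → α} {v : α → K}
    (hv : Function.Injective v) (hwv : ∀ i, v (w i) = ζ * v i) :
    d ∣ (Finset.univ.filter fun i => v i ≠ 0).card := by
  classical
  rw [Finset.card_eq_sum_card_image fun i => v i ^ d]
  refine Finset.dvd_sum fun c hc => ?_
  obtain ⟨i, hi, rfl⟩ := Finset.mem_image.1 hc
  have hi : v i ≠ 0 := (Finset.mem_filter.1 hi).2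
  have hfiber : ((Finset.univ.filter fun j => v j ≠ 0).filter fun j => v j ^ d = v i ^ d) =
      (Finset.range d).image fun k => w^[k] i := by
    ext j
    simp only [Finset.mem_filter, Finset.mem_univ, true_and, Finset.mem_image, Finset.mem_range]
    constructor
    · rintro ⟨-, h⟩
      have : NeZero d := ⟨hd.ne'⟩
      obtain ⟨k, hk, hkζ⟩ := hζ.eq_pow_of_pow_eq_one (ξ := v j / v i)
        (by rw [div_pow, h, div_self (pow_ne_zero _ hi)])
      refine ⟨k, hk, hv ?_⟩
      rw [apply_iterate_eq_pow_mul hwv, hkζ, div_mul_cancel₀ _ hi]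
    · rintro ⟨k, -, rfl⟩
      rw [apply_iterate_eq_pow_mul hwv]
      refine ⟨mul_ne_zero (pow_ne_zero _ (hζ.ne_zero hd.ne')) hi, ?_⟩
      rw [mul_pow, ← pow_mul, mul_comm k, pow_mul, hζ.pow_eq_one, one_pow, one_mul]
  rw [hfiber, Finset.card_image_of_injOn, Finset.card_range]
  intro k hk l hl h
  have h := congrArg v h
  simp only [apply_iterate_eq_pow_mul hwv] at h
  exact hζ.pow_inj (Finset.mem_range.1 hk) (Finset.mem_range.1 hl) (mul_right_cancel₀ hi h)

/-- If `v ∈ ℂⁿ` has pairwise distinct coordinates, `ζ` is a primitive `d`-th root of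
unity (`d ≥ 2`), and the permutation `w` satisfies `v(w(i)) = ζ·v(i)` for all `i`, then
every orbit of `w` on `{1, …, n}` has cardinality `d` or `1`, at most one orbit has
cardinality `1`, and `n mod d ∈ {0, 1}`. -/
theorem stmt17 (n d : ℕ) (hn : 2 ≤ n) (hd : 2 ≤ d) (ζ : ℂ) (hζ : IsPrimitiveRoot ζ d)
    (w : Equiv.Perm (Fin n)) (v : Fin n → ℂ) (hv : Function.Injective v)
    (hwv : ∀ i : Fin n, v (w i) = ζ * v i) :
    (∀ i : Fin n, Function.minimalPeriod (⇑w) i = d ∨ Function.minimalPeriod (⇑w) i = 1) ∧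
    (∀ i j : Fin n, w i = i → w j = j → i = j) ∧
    (n % d = 0 ∨ n % d = 1) := by
  refine ⟨fun i => ?_, fun i j hi hj => ?_, ?_⟩
  · by_cases hi : v i = 0
    · right
      rw [Function.minimalPeriod_eq_one_iff_isFixedPt]
      exact hv (by rw [hwv, hi, mul_zero])
    · exact .inl (minimalPeriod_eq_of_apply_ne_zero hζ hv hwv hi)
  · have hzero (k : Fin n) (hk : w k = k) : v k = 0 := by
      have h := hwv k
      rw [hk] at h
      by_contra hk0
      exact hζ.ne_one hd ((mul_eq_right₀ hk0).1 h.symm)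
    exact hv ((hzero i hi).trans (hzero j hj).symm)
  · obtain ⟨r, hr⟩ := dvd_card_filter_apply_ne_zero (by lia) hζ hv hwv
    have hsum := Finset.card_filter_add_card_filter_not (s := Finset.univ) fun i => v i = 0
    have hle : (Finset.univ.filter fun i => v i = 0).card ≤ 1 := by
      rw [Finset.card_le_one]
      intro i hi j hj
      exact hv ((Finset.mem_filter.1 hi).2.trans (Finset.mem_filter.1 hj).2.symm)
    rw [Finset.card_univ, Fintype.card_fin, hr] at hsum
    rw [← hsum, Nat.add_mul_mod_self_left, Nat.mod_eq_of_lt (by lia)]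
    lia
end
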